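/- The sum of 1/|γ| over the real numbers γ ≠ 0 such that ζ(1/2 + iγ) = 0 diverges; that is, the function γ ↦ 1/|γ| on the set {γ ∈ ℝ : γ ≠ 0 and riemannZeta(1/2 + iγ) = 0} is not summable. -/

import Mathlib

open Filter Topology in
/-- Along `[1/2, 3/2]`, the ratio `x / |x + j + iτ|` is logarithmically concave. -/
theorem concaveOn_log_sub_log_norm (τ : ℝ) :
    ConcaveOn ℝ (Set.Ioi 0) (fun x : ℝ => Real.log x - Real.log (x ^ 2 + τ ^ 2) / 2) := by
  have hd : ∀ x ∈ Set.Ioi (0 : ℝ), HasDerivAt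
      (fun x : ℝ => Real.log x - Real.log (x ^ 2 + τ ^ 2) / 2)
      (τ ^ 2 / (x * (x ^ 2 + τ ^ 2))) x := by
    intro x (hx : 0 < x)
    have h1 : HasDerivAt (fun x : ℝ => x ^ 2 + τ ^ 2) (2 * x) x := by
      simpa using (hasDerivAt_pow 2 x).add_const (τ ^ 2)
    have hne : x ^ 2 + τ ^ 2 ≠ 0 := by positivity
    refine ((Real.hasDerivAt_log hx.ne').sub ((h1.log hne).div_const 2)).congr_deriv ?_
    field_simp
    ring
  refine AntitoneOn.concaveOn_of_deriv (convex_Ioi 0)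
    (fun x hx => (hd x hx).continuousAt.continuousWithinAt) ?_ ?_
  · rw [interior_Ioi]
    exact fun x hx => (hd x hx).differentiableAt.differentiableWithinAt
  · rw [interior_Ioi]
    intro x hx y hy hxy
    rw [(hd x hx).deriv, (hd y hy).deriv]
    have : 0 < x := hx
    have : 0 < y := hy
    gcongr

theorem norm_GammaSeq_add_mul_I {x τ : ℝ} (hx : 0 < x) {n : ℕ} (hn : n ≠ 0) :
    ‖Complex.GammaSeq (x + τ * Complex.I) n‖ = Real.GammaSeq x n *
      Real.exp (∑ j ∈ Finset.range (n + 1),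
        (Real.log (x + j) - Real.log ((x + j) ^ 2 + τ ^ 2) / 2)) := by
  have hn' : (0 : ℝ) < n := by positivity
  have hnorm : ∀ j : ℕ, ‖(x + τ * Complex.I + j : ℂ)‖ = √((x + j) ^ 2 + τ ^ 2) := by
    intro j
    rw [← Complex.norm_add_mul_I]
    push_cast
    ring_nf
  rw [Complex.GammaSeq, Real.GammaSeq, norm_div, norm_mul, norm_prod, Real.exp_sum,
    Complex.norm_natCast_cpow_of_pos (Nat.pos_of_ne_zero hn)]
  have he : ∀ j : ℕ, Real.exp (Real.log (x + j) - Real.log ((x + j) ^ 2 + τ ^ 2) / 2)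
      = (x + j) / √((x + j) ^ 2 + τ ^ 2) := by
    intro j
    have : 0 < x + j := by positivity
    rw [Real.exp_sub, Real.exp_log this, ← Real.log_sqrt (by positivity),
      Real.exp_log (by positivity)]
  simp_rw [he, hnorm, Finset.prod_div_distrib]
  have h1 : ∏ j ∈ Finset.range (n + 1), (x + j) ≠ 0 :=
    Finset.prod_ne_zero_iff.mpr fun j _ => by positivity
  have h2 : ∏ j ∈ Finset.range (n + 1), √((x + j) ^ 2 + τ ^ 2) ≠ 0 :=
    Finset.prod_ne_zero_iff.mpr fun j _ => by positivity
  simp only [Complex.norm_natCast, Complex.add_re, Complex.ofReal_re, Complex.mul_re,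
    Complex.I_re, Complex.I_im, Complex.ofReal_im]
  field_simp
  simp

theorem norm_Gamma_half_add_mul_I_ge (τ : ℝ) (hτ : 0 ≤ τ) :
    Real.exp (-(Real.pi * τ / 2)) * √Real.pi ≤ ‖Complex.Gamma (1 / 2 + τ * Complex.I)‖ := by
  have h := Complex.Gamma_mul_Gamma_one_sub (1 / 2 + τ * Complex.I)
  have hc : (1 - (1 / 2 + τ * Complex.I) : ℂ) =
      (starRingEnd ℂ) (1 / 2 + τ * Complex.I) := by
    apply Complex.ext <;> simp
    norm_num
  rw [hc, Complex.Gamma_conj, Complex.mul_conj, mul_add,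
    show (Real.pi * (1 / 2) + Real.pi * (τ * Complex.I) : ℂ)
      = ((Real.pi * τ : ℝ) : ℂ) * Complex.I + Real.pi / 2 by push_cast; ring,
    Complex.sin_add_pi_div_two, Complex.cos_mul_I, ← Complex.ofReal_cosh,
    ← Complex.ofReal_div, Complex.ofReal_inj, Complex.normSq_eq_norm_sq] at h
  have hcosh : Real.cosh (Real.pi * τ) ≤ Real.exp (Real.pi * τ) := by
    rw [Real.cosh_eq]
    have : Real.exp (-(Real.pi * τ)) ≤ Real.exp (Real.pi * τ) := by
      apply Real.exp_le_exp.mpr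
      have : 0 ≤ Real.pi * τ := by positivity
      linarith
    linarith
  apply le_of_sq_le_sq _ (norm_nonneg _)
  rw [h, mul_pow, Real.sq_sqrt Real.pi_pos.le, ← Real.exp_nat_mul, le_div_iff₀ (Real.cosh_pos _)]
  calc Real.exp ((2 : ℕ) * -(Real.pi * τ / 2)) * Real.pi * Real.cosh (Real.pi * τ)
      ≤ Real.exp ((2 : ℕ) * -(Real.pi * τ / 2)) * Real.pi * Real.exp (Real.pi * τ) := by gcongr
    _ = Real.pi := by
        rw [mul_right_comm, ← Real.exp_add]
        simp
        ring_nf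

open Filter Topology in
theorem norm_Gamma_div_Gamma_ge {x τ : ℝ} (hx : x ∈ Set.Icc (1 / 2 : ℝ) (3 / 2)) (hτ : 1 ≤ τ) :
    Real.Gamma x * (τ ^ (x - 1 / 2) * Real.exp (-(Real.pi * τ / 2)))
      ≤ ‖Complex.Gamma (x + τ * Complex.I)‖ := by
  obtain ⟨hx1, hx2⟩ := hx
  set l := x - 1 / 2 with hl
  have hx0 : 0 < x := by linarith
  have hτ0 : 0 < τ := by linarith
  let R : ℝ → ℝ := fun y => ‖Complex.Gamma (y + τ * Complex.I)‖ / Real.Gamma y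
  let E : ℝ → ℕ → ℝ := fun y n => ∑ j ∈ Finset.range (n + 1),
        (Real.log (y + j) - Real.log ((y + j) ^ 2 + τ ^ 2) / 2)
  have hlim : ∀ y : ℝ, 0 < y → Tendsto (fun n => Real.exp (E y n)) atTop (𝓝 (R y)) := by
    intro y hy
    have h1 := (Complex.GammaSeq_tendsto_Gamma (y + τ * Complex.I)).norm
    have h2 := Real.GammaSeq_tendsto_Gamma y
    refine (h1.div h2 (Real.Gamma_pos_of_pos hy).ne').congr' ?_
    filter_upwards [eventually_ne_atTop 0] with n hn
    simp only [Pi.div_apply]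
    rw [norm_GammaSeq_add_mul_I hy hn]
    have : Real.GammaSeq y n ≠ 0 := by
      rw [Real.GammaSeq]
      have : (0 : ℝ) < n := by positivity
      have h2 : ∏ j ∈ Finset.range (n + 1), (y + j) ≠ 0 :=
        Finset.prod_ne_zero_iff.mpr fun j _ => by positivity
      positivity
    rw [mul_div_cancel_left₀ _ this]
  have hconc : ∀ n, (1 - l) * E (1 / 2) n + l * E (3 / 2) n ≤ E x n := by
    intro n
    simp only [E, Finset.mul_sum, ← Finset.sum_add_distrib]
    refine Finset.sum_le_sum fun j _ => ?_
    have := ((concaveOn_log_sub_log_norm τ).2) (x := 1 / 2 + j) (y := 3 / 2 + j)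
      (Set.mem_Ioi.mpr (by positivity)) (Set.mem_Ioi.mpr (by positivity))
      (a := 1 - l) (b := l) (by linarith) (by linarith) (by ring)
    simp only [smul_eq_mul] at this
    rw [show (1 - l) * (1 / 2 + (j : ℝ)) + l * (3 / 2 + j) = x + j by rw [hl]; ring] at this
    exact this
  have hge : R (1 / 2) ^ (1 - l) * R (3 / 2) ^ l ≤ R x := by
    refine le_of_tendsto_of_tendsto
      (((hlim (1 / 2) (by norm_num)).rpow_const (Or.inr (by linarith))).mul
      ((hlim (3 / 2) (by norm_num)).rpow_const (Or.inr (by linarith)))) (hlim x hx0)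
      (Eventually.of_forall fun n => ?_)
    simp only
    rw [← Real.exp_mul, ← Real.exp_mul, ← Real.exp_add]
    apply Real.exp_le_exp.mpr
    linarith [hconc n]
  have hhalf : Real.exp (-(Real.pi * τ / 2)) ≤ R (1 / 2) := by
    simp only [R]
    rw [le_div_iff₀ (Real.Gamma_pos_of_pos (by norm_num)), Real.Gamma_one_half_eq]
    have := norm_Gamma_half_add_mul_I_ge τ hτ0.le
    push_cast
    exact this
  have hthree : τ * Real.exp (-(Real.pi * τ / 2)) ≤ R (3 / 2) := by
    have h32 : Real.Gamma (3 / 2) = 1 / 2 * Real.Gamma (1 / 2) := by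
      rw [← Real.Gamma_add_one (by norm_num)]; norm_num
    have hC : Complex.Gamma ((3 / 2 : ℝ) + τ * Complex.I) =
        (1 / 2 + τ * Complex.I) * Complex.Gamma (1 / 2 + τ * Complex.I) := by
      rw [← Complex.Gamma_add_one]
      · congr 1; push_cast; ring
      · intro h
        have := congrArg Complex.re h
        simp at this
    have hn : τ ≤ ‖(1 / 2 + τ * Complex.I : ℂ)‖ := by
      have := Complex.abs_im_le_norm (1 / 2 + τ * Complex.I : ℂ)
      simp only [Complex.add_im, Complex.mul_im, Complex.ofReal_re, Complex.I_im,
        Complex.ofReal_im, Complex.I_re] at this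
      norm_num at this
      rw [abs_of_pos hτ0] at this
      simpa using this
    have hg : 0 < Real.Gamma (1 / 2) := Real.Gamma_pos_of_pos (by norm_num)
    have hR : R (3 / 2) = 2 * ‖(1 / 2 + τ * Complex.I : ℂ)‖ * R (1 / 2) := by
      simp only [R]
      rw [h32, hC, norm_mul]
      push_cast
      field_simp
    rw [hR]
    have : 0 ≤ Real.exp (-(Real.pi * τ / 2)) := (Real.exp_pos _).le
    gcongr
    linarith
  have hfin : τ ^ l * Real.exp (-(Real.pi * τ / 2)) ≤ R x := by
    refine le_trans ?_ hge
    have hl1 : 0 ≤ 1 - l := by linarith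
    have hl0 : 0 ≤ l := by linarith
    calc τ ^ l * Real.exp (-(Real.pi * τ / 2))
        = Real.exp (-(Real.pi * τ / 2)) ^ (1 - l) *
          (τ * Real.exp (-(Real.pi * τ / 2))) ^ l := by
          rw [Real.mul_rpow hτ0.le (Real.exp_pos _).le, mul_left_comm, ← Real.rpow_add
            (Real.exp_pos _)]
          simp
      _ ≤ _ := by
          apply mul_le_mul (Real.rpow_le_rpow (Real.exp_pos _).le hhalf hl1)
            (Real.rpow_le_rpow (by positivity) hthree hl0) (by positivity)
          exact Real.rpow_nonneg ((Real.exp_pos _).le.trans hhalf) _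
  rw [mul_comm]
  exact (le_div_iff₀ (Real.Gamma_pos_of_pos hx0)).mp hfin

/-- A lower bound of the correct order for `Γ` in a vertical strip. -/
theorem exists_norm_Gamma_ge : ∃ c : ℝ, 0 < c ∧ ∀ x ∈ Set.Icc (1 / 4 : ℝ) (3 / 2), ∀ τ : ℝ, 1 ≤ τ →
    c * (τ ^ (x - 1 / 2) * Real.exp (-(Real.pi * τ / 2)))
      ≤ ‖Complex.Gamma (x + τ * Complex.I)‖ := by
  have hpos : ∀ x ∈ Set.Icc (1 / 2 : ℝ) (3 / 2), (0 : ℝ) < x := by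
    rintro x ⟨h1, h2⟩
    linarith
  obtain ⟨x₀, hx₀, hmin⟩ := (isCompact_Icc (a := (1 / 2 : ℝ)) (b := 3 / 2)).exists_isMinOn
    (Set.nonempty_Icc.mpr (by norm_num)) (f := Real.Gamma)
    (fun x hx => (Real.differentiableAt_Gamma
      (fun m => by have := hpos x hx; have : (0 : ℝ) ≤ m := m.cast_nonneg; linarith)).continuousAt.continuousWithinAt)
  have hc : 0 < Real.Gamma x₀ := Real.Gamma_pos_of_pos (hpos _ hx₀)
  have key : ∀ x ∈ Set.Icc (1 / 2 : ℝ) (3 / 2), ∀ τ : ℝ, 1 ≤ τ →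
      Real.Gamma x₀ * (τ ^ (x - 1 / 2) * Real.exp (-(Real.pi * τ / 2)))
      ≤ ‖Complex.Gamma (x + τ * Complex.I)‖ := by
    intro x hx τ hτ
    refine le_trans ?_ (norm_Gamma_div_Gamma_ge hx hτ)
    have := hmin hx
    simp only [Set.mem_ofPred_eq] at this
    gcongr
  refine ⟨Real.Gamma x₀ / 2, by positivity, fun x hx τ hτ => ?_⟩
  have hτ0 : 0 < τ := by linarith
  rcases le_or_gt (1 / 2) x with h | h
  · refine le_trans ?_ (key x ⟨h, hx.2⟩ τ hτ)
    gcongr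
    linarith
  · have hk := key (x + 1) ⟨by linarith [hx.1], by linarith⟩ τ hτ
    have hG : Complex.Gamma ((x + 1 : ℝ) + τ * Complex.I) =
        (x + τ * Complex.I) * Complex.Gamma (x + τ * Complex.I) := by
      rw [← Complex.Gamma_add_one]
      · congr 1; push_cast; ring
      · intro h
        have := congrArg Complex.im h
        simp at this
        linarith
    have hn : ‖(x + τ * Complex.I : ℂ)‖ ≤ 2 * τ := by
      refine (norm_add_le _ _).trans ?_
      simp only [Complex.norm_real, norm_mul, Complex.norm_I, mul_one, Real.norm_eq_abs]
      rw [abs_of_pos hτ0, abs_of_pos (by linarith [hx.1])]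
      linarith
    rw [hG, norm_mul, show x + 1 - 1 / 2 = (x - 1 / 2) + 1 by ring,
      Real.rpow_add_one hτ0.ne'] at hk
    have : Real.Gamma x₀ * (τ ^ (x - 1 / 2) * τ * Real.exp (-(Real.pi * τ / 2))) ≤
        2 * τ * ‖Complex.Gamma (x + τ * Complex.I)‖ := hk.trans (by gcongr)
    have h2 : (2 * τ) * (Real.Gamma x₀ / 2 * (τ ^ (x - 1 / 2) * Real.exp (-(Real.pi * τ / 2))))
        ≤ 2 * τ * ‖Complex.Gamma (x + τ * Complex.I)‖ := by
      refine le_trans (le_of_eq ?_) this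
      ring
    exact le_of_mul_le_mul_left h2 (by positivity)

open MeasureTheory FourierTransform in
/-- The Fourier transform of `L² ∩ L¹` functions computed by the integral formula agrees with the
one on `L²`. -/
theorem fourier_toLp_ae_eq {g : ℝ → ℂ} (h1 : Integrable g) (h2 : MemLp g 2) :
    (𝓕 (h2.toLp g) : Lp ℂ 2) =ᵐ[volume] 𝓕 g := by
  have hcont : Continuous (𝓕 g) :=
    VectorFourier.fourierIntegral_continuous Real.continuous_fourierChar
      (by exact continuous_inner) h1
  refine ae_eq_of_integral_contDiff_smul_eq
    ((Lp.memLp _).locallyIntegrable (by norm_num)) hcont.locallyIntegrable ?_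
  intro φ hφ hφc
  have hφc' : HasCompactSupport (fun x => (φ x : ℂ)) := hφc.comp_left (g := fun x : ℝ => (x : ℂ)) rfl
  have hφ' : ContDiff ℝ (⊤ : ℕ∞) (fun x => (φ x : ℂ)) := Complex.ofRealCLM.contDiff.comp hφ
  set ψ : SchwartzMap ℝ ℂ := hφc'.toSchwartzMap hφ' with hψ
  have hψv : ∀ x, ψ x = (φ x : ℂ) := fun x => rfl
  have e1 := congrArg (fun T : TemperedDistribution ℝ ℂ => T ψ)
    (Lp.fourier_toTemperedDistribution_eq (h2.toLp g))
  simp only [TemperedDistribution.fourier_apply, Lp.toTemperedDistribution_apply, hψv] at e1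
  have e2 : ∫ x, (𝓕 ψ) x • (h2.toLp g) x = ∫ x, (𝓕 (ψ : ℝ → ℂ)) x • g x := by
    rw [SchwartzMap.fourier_coe]
    refine integral_congr_ae ?_
    filter_upwards [h2.coeFn_toLp] with x hx
    rw [hx]
  have e3 : ∫ x, (𝓕 (ψ : ℝ → ℂ)) x • g x = ∫ x, ψ x • (𝓕 g) x := by
    simpa using! VectorFourier.integral_fourierIntegral_smul_eq_flip (L := innerₗ ℝ)
      Real.continuous_fourierChar continuous_inner (ψ.integrable (μ := volume)) h1
  rw [e2, e3] at e1
  simpa [hψv] using e1.symm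

open MeasureTheory FourierTransform in
/-- Plancherel's inequality for integrable functions. -/
theorem lintegral_enorm_fourier_sq_le {g : ℝ → ℂ} (h1 : Integrable g) :
    ∫⁻ ξ, ‖𝓕 g ξ‖ₑ ^ 2 ≤ ∫⁻ x, ‖g x‖ₑ ^ 2 := by
  have hn : ∀ f : ℝ → ℂ, eLpNorm f 2 volume = (∫⁻ x, ‖f x‖ₑ ^ 2) ^ (1 / 2 : ℝ) := by
    intro f
    rw [eLpNorm_eq_lintegral_rpow_enorm_toReal (by norm_num) (by norm_num)]
    simp
  by_cases h : ∫⁻ x, ‖g x‖ₑ ^ 2 = ⊤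
  · rw [h]; exact le_top
  have h2 : MemLp g 2 := by
    refine ⟨h1.1, ?_⟩
    rw [hn]
    exact ENNReal.rpow_lt_top_of_nonneg (by norm_num) h
  have e : eLpNorm (𝓕 g) 2 volume = eLpNorm g 2 volume := by
    rw [← eLpNorm_congr_ae (fourier_toLp_ae_eq h1 h2), ← eLpNorm_congr_ae h2.coeFn_toLp,
      ← Lp.enorm_def, ← Lp.enorm_def, ← ofReal_norm, ← ofReal_norm, Lp.norm_fourier_eq]
  rw [hn, hn] at e
  exact (ENNReal.rpow_left_injective (by norm_num) e).le

theorem Finset.sum_range_sum_range_eq_sum_diag_add {M : Type*} [AddCommMonoid M]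
    (G : ℕ → ℕ → M) (N : ℕ) :
    ∑ m ∈ Finset.range N, ∑ n ∈ Finset.range N, G m n =
      ∑ k ∈ Finset.range N, (G k k + ∑ m ∈ Finset.range k, (G m k + G k m)) := by
  induction N with
  | zero => simp
  | succ N ih =>
    rw [Finset.sum_range_succ,
      Finset.sum_range_succ (fun k => G k k + ∑ m ∈ Finset.range k, (G m k + G k m)), ← ih]
    simp_rw [Finset.sum_range_succ _ N, Finset.sum_add_distrib]
    abel

theorem norm_sum_mul_exp_sq (b l : ℕ → ℝ) (p q x : ℝ) (N : ℕ) :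
    ‖∑ n ∈ Finset.range N, (b n : ℂ) * Complex.exp (-(l n * x * (p + q * Complex.I)))‖ ^ 2 =
      ∑ m ∈ Finset.range N, ∑ n ∈ Finset.range N, b m * b n *
        (Complex.exp (-((l m + l n) * p + (l m - l n) * q * Complex.I) * x)).re := by
  rw [← Complex.ofReal_inj, Complex.ofReal_pow, ← Complex.mul_conj', map_sum, Finset.sum_mul_sum,
    Complex.ofReal_sum]
  have : ∀ z : ℂ, z.im = 0 → z = z.re := fun z hz => Complex.ext rfl (by simpa using hz)
  rw [this (∑ m ∈ Finset.range N, _)]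
  · rw [Complex.re_sum, Complex.ofReal_sum]
    refine Finset.sum_congr rfl fun m _ => ?_
    rw [Complex.re_sum, Complex.ofReal_inj]
    refine Finset.sum_congr rfl fun n _ => ?_
    rw [map_mul, ← Complex.exp_conj, Complex.conj_ofReal, mul_mul_mul_comm, ← Complex.exp_add,
      ← Complex.ofReal_mul, Complex.re_ofReal_mul]
    congr 3
    simp
    ring
  · rw [← Finset.sum_mul_sum, ← map_sum, Complex.mul_conj']
    norm_cast

theorem abs_integral_re_exp_le {α β X Y : ℝ} (hα : 0 ≤ α) (hβ : β ≠ 0) (hXY : X ≤ Y) :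
    |∫ x in X..Y, (Complex.exp (-(α + β * Complex.I) * x)).re| ≤
      2 * Real.exp (-(α * X)) / |β| := by
  have hc : -((α : ℂ) + β * Complex.I) ≠ 0 := by
    intro h
    have := congrArg Complex.im h
    simp at this
    exact hβ this
  have hre : ∫ x in X..Y, (Complex.exp (-(α + β * Complex.I) * x)).re =
      (∫ x in X..Y, Complex.exp (-(α + β * Complex.I) * x)).re :=
    (Complex.reCLM.intervalIntegral_comp_comm
      ((by fun_prop : Continuous fun x : ℝ =>
        Complex.exp (-(α + β * Complex.I) * x)).intervalIntegrable X Y))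
  rw [hre, integral_exp_mul_complex hc]
  refine (Complex.abs_re_le_norm _).trans ?_
  rw [norm_div]
  have hden : |β| ≤ ‖-((α : ℂ) + β * Complex.I)‖ := by
    have := Complex.abs_im_le_norm (-((α : ℂ) + β * Complex.I))
    simpa using this
  have hnorm : ∀ y : ℝ, ‖Complex.exp (-(α + β * Complex.I) * y)‖ = Real.exp (-(α * y)) := by
    intro y
    rw [Complex.norm_exp]
    simp
  have hle : Real.exp (-(α * Y)) ≤ Real.exp (-(α * X)) := by
    gcongr
  have hnum : ‖Complex.exp (-(α + β * Complex.I) * Y) - Complex.exp (-(α + β * Complex.I) * X)‖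
      ≤ 2 * Real.exp (-(α * X)) := by
    refine (norm_sub_le _ _).trans ?_
    rw [hnorm, hnorm]
    linarith
  have : 0 < |β| := abs_pos.mpr hβ
  gcongr

theorem sum_inv_sub_le (k : ℕ) :
    ∑ m ∈ Finset.range k, (1 : ℝ) / (k - m) ≤ 2 * √k := by
  rw [← Finset.sum_range_reflect]
  have : ∀ m ∈ Finset.range k, (1 : ℝ) / (k - ((k - 1 - m : ℕ) : ℝ)) = 1 / (m + 1) := by
    intro m hm
    have hm' := Finset.mem_range.mp hm
    rw [Nat.cast_sub (by omega), Nat.cast_sub (by omega)]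
    congr 1
    push_cast
    ring
  rw [Finset.sum_congr rfl this]
  clear this
  induction k with
  | zero => simp
  | succ k ih =>
    rw [Finset.sum_range_succ]
    have h1 : √(k : ℝ) ≤ √((k + 1 : ℕ) : ℝ) := Real.sqrt_le_sqrt (by push_cast; linarith)
    have h2 : √((k + 1 : ℕ) : ℝ) ^ 2 = k + 1 := by
      rw [Real.sq_sqrt (by positivity)]; push_cast; ring
    have h3 : √(k : ℝ) ^ 2 = k := Real.sq_sqrt (by positivity)
    set u := √((k + 1 : ℕ) : ℝ)
    set v := √(k : ℝ)
    have hv : 0 ≤ v := Real.sqrt_nonneg _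
    have hu : 1 ≤ u := by
      rw [Real.one_le_sqrt]
      push_cast
      linarith [k.cast_nonneg (α := ℝ)]
    have : (1 : ℝ) / (k + 1) ≤ 2 * (u - v) := by
      rw [← h2, div_le_iff₀ (by positivity)]
      have : 2 * (u - v) * u ^ 2 ≥ (u - v) * (u + v) * u := by
        nlinarith [mul_nonneg (mul_nonneg (sub_nonneg.2 h1) (by linarith : 0 ≤ u))
          (sub_nonneg.2 h1)]
      have h4 : (u - v) * (u + v) = 1 := by nlinarith
      rw [h4] at this
      linarith
    linarith

theorem sum_exp_neg_sq_le {α : ℝ} (hα : 0 < α) (N : ℕ) :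
    ∑ k ∈ Finset.range N, Real.exp (-(α * ((k : ℝ) + 1) ^ 2)) ≤ α ^ (-(1 / 2) : ℝ) := by
  have hanti : AntitoneOn (fun x : ℝ => Real.exp (-α * x ^ 2)) (Set.Icc 0 (0 + (N : ℝ))) := by
    intro x hx y hy hxy
    apply Real.exp_le_exp.mpr
    have : x ^ 2 ≤ y ^ 2 := pow_le_pow_left₀ hx.1 hxy 2
    nlinarith
  have h1 := hanti.sum_le_integral
  have h2 : ∫ x in (0 : ℝ)..0 + N, Real.exp (-α * x ^ 2) ≤ √(Real.pi / α) / 2 := by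
    rw [← integral_gaussian_Ioi, intervalIntegral.integral_of_le (by simp)]
    refine MeasureTheory.setIntegral_mono_set (integrable_exp_neg_mul_sq hα).integrableOn
      (Filter.Eventually.of_forall fun x => (Real.exp_pos _).le) ?_
    exact Set.Ioc_subset_Ioi_self.eventuallyLE
  have h3 : √(Real.pi / α) / 2 ≤ α ^ (-(1 / 2) : ℝ) := by
    rw [Real.rpow_neg hα.le, ← Real.sqrt_eq_rpow, Real.sqrt_div Real.pi_pos.le]
    have h4 : √Real.pi ≤ 2 := by
      rw [Real.sqrt_le_left (by norm_num)]
      linarith [Real.pi_le_four]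
    have : 0 < √α := Real.sqrt_pos.mpr hα
    rw [div_div, ← one_div, div_le_div_iff₀ (by positivity) this]
    nlinarith
  refine le_trans (le_of_eq ?_) (h1.trans (h2.trans h3))
  refine Finset.sum_congr rfl fun k _ => ?_
  congr 1
  push_cast
  ring

theorem exists_sum_exp_neg_sq_mul_rpow_le : ∃ C : ℝ, 0 < C ∧ ∀ α : ℝ, 0 < α → ∀ N : ℕ,
    ∑ k ∈ Finset.range N, Real.exp (-(α * ((k : ℝ) + 1) ^ 2)) * ((k : ℝ) + 1) ^ (-(1 / 2) : ℝ) ≤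
      C * α ^ (-(3 / 8) : ℝ) := by
  have hs : Summable fun k : ℕ => ((k : ℝ) + 1) ^ (-(5 / 4) : ℝ) := by
    have := (summable_nat_add_iff 1).mpr
      (Real.summable_nat_rpow.mpr (by norm_num : (-(5 / 4) : ℝ) < -1))
    simpa using this
  refine ⟨∑' k : ℕ, ((k : ℝ) + 1) ^ (-(5 / 4) : ℝ), ?_, fun α hα N => ?_⟩
  · exact hs.tsum_pos (fun k => by positivity) 0 (by simp)
  have hterm : ∀ k : ℕ, Real.exp (-(α * ((k : ℝ) + 1) ^ 2)) * ((k : ℝ) + 1) ^ (-(1 / 2) : ℝ) ≤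
      ((k : ℝ) + 1) ^ (-(5 / 4) : ℝ) * α ^ (-(3 / 8) : ℝ) := by
    intro k
    have hk : (0 : ℝ) < k + 1 := by positivity
    set u := α * ((k : ℝ) + 1) ^ 2 with hu
    have hu0 : 0 < u := by positivity
    have h1 : Real.exp (-u) ≤ u ^ (-(3 / 8) : ℝ) := by
      rw [Real.exp_neg, Real.rpow_neg hu0.le]
      refine inv_anti₀ (by positivity) ?_
      calc u ^ (3 / 8 : ℝ) ≤ (1 + u) ^ (3 / 8 : ℝ) := by gcongr; linarith
        _ ≤ (1 + u) ^ (1 : ℝ) := by gcongr <;> linarith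
        _ = u + 1 := by rw [Real.rpow_one]; ring
        _ ≤ Real.exp u := Real.add_one_le_exp u
    have h2 : u ^ (-(3 / 8) : ℝ) = ((k : ℝ) + 1) ^ (-(3 / 4) : ℝ) * α ^ (-(3 / 8) : ℝ) := by
      rw [hu, Real.mul_rpow hα.le (by positivity), ← Real.rpow_natCast, ← Real.rpow_mul hk.le]
      norm_num
      ring
    calc Real.exp (-u) * ((k : ℝ) + 1) ^ (-(1 / 2) : ℝ)
        ≤ u ^ (-(3 / 8) : ℝ) * ((k : ℝ) + 1) ^ (-(1 / 2) : ℝ) := by gcongr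
      _ = ((k : ℝ) + 1) ^ (-(5 / 4) : ℝ) * α ^ (-(3 / 8) : ℝ) := by
        rw [h2, mul_right_comm, ← Real.rpow_add hk]
        norm_num
  calc _ ≤ ∑ k ∈ Finset.range N, ((k : ℝ) + 1) ^ (-(5 / 4) : ℝ) * α ^ (-(3 / 8) : ℝ) :=
        Finset.sum_le_sum fun k _ => hterm k
    _ = (∑ k ∈ Finset.range N, ((k : ℝ) + 1) ^ (-(5 / 4) : ℝ)) * α ^ (-(3 / 8) : ℝ) := by
        rw [Finset.sum_mul]
    _ ≤ _ := by
        gcongr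
        exact hs.sum_le_tsum _ fun k _ => by positivity

/-- A mean square estimate over a window for a theta-like exponential sum with bounded
coefficients. -/
theorem exists_integral_norm_sum_sq_le : ∃ C : ℝ, 0 < C ∧ ∀ b : ℕ → ℝ, (∀ n, |b n| ≤ 2) →
    ∀ p q X Y : ℝ, 0 < p → 1 / 4 ≤ q → 0 < X → X ≤ Y → ∀ N : ℕ,
    ∫ x in X..Y, ‖∑ n ∈ Finset.range N, (b n : ℂ) *
      Complex.exp (-((((n : ℝ) + 1) ^ 2 : ℝ) * x * (p + q * Complex.I)))‖ ^ 2 ≤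
    C * Real.exp (-(p * X / 2)) *
      ((Y - X) * (p * X) ^ (-(1 / 2) : ℝ) + (p * X) ^ (-(3 / 8) : ℝ)) := by
  obtain ⟨C₀, hC₀, hsum⟩ := exists_sum_exp_neg_sq_mul_rpow_le
  refine ⟨4 + 128 * C₀ * (2 : ℝ) ^ (3 / 8 : ℝ), by positivity, ?_⟩
  intro b hb p q X Y hp hq hX hXY N
  set l : ℕ → ℝ := fun n => ((n : ℝ) + 1) ^ 2 with hl
  set α := p * X with hα
  have hα0 : 0 < α := by positivity
  have hq0 : 0 < q := by linarith
  let I : ℕ → ℕ → ℝ := fun m n => ∫ x in X..Y,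
    (Complex.exp (-((((l m + l n) * p : ℝ) : ℂ) + (((l m - l n) * q : ℝ) : ℂ) * Complex.I) * x)).re
  have hexp : ∫ x in X..Y, ‖∑ n ∈ Finset.range N, (b n : ℂ) *
      Complex.exp (-((((n : ℝ) + 1) ^ 2 : ℝ) * x * (p + q * Complex.I)))‖ ^ 2 =
      ∑ m ∈ Finset.range N, ∑ n ∈ Finset.range N, b m * b n * I m n := by
    have h1 : ∀ x : ℝ, ‖∑ n ∈ Finset.range N, (b n : ℂ) *
      Complex.exp (-((((n : ℝ) + 1) ^ 2 : ℝ) * x * (p + q * Complex.I)))‖ ^ 2 =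
      ∑ m ∈ Finset.range N, ∑ n ∈ Finset.range N, b m * b n *
        (Complex.exp (-((((l m + l n) * p : ℝ) : ℂ) +
          (((l m - l n) * q : ℝ) : ℂ) * Complex.I) * x)).re := by
      intro x
      rw [norm_sum_mul_exp_sq b l p q x N]
      push_cast
      rfl
    simp_rw [h1]
    have hci : ∀ m n : ℕ, IntervalIntegrable (fun x : ℝ => b m * b n *
        (Complex.exp (-((((l m + l n) * p : ℝ) : ℂ) +
          (((l m - l n) * q : ℝ) : ℂ) * Complex.I) * x)).re) MeasureTheory.volume X Y := by
      intro m n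
      apply Continuous.intervalIntegrable
      exact continuous_const.mul (Complex.continuous_re.comp (by fun_prop))
    rw [intervalIntegral.integral_finsetSum]
    · refine Finset.sum_congr rfl fun m _ => ?_
      rw [intervalIntegral.integral_finsetSum (fun n _ => hci m n)]
      refine Finset.sum_congr rfl fun n _ => ?_
      rw [intervalIntegral.integral_const_mul]
    · intro m _
      have := IntervalIntegrable.sum (Finset.range N) (fun n _ => hci m n)
      simpa only [Finset.sum_fn] using this
  rw [hexp, Finset.sum_range_sum_range_eq_sum_diag_add]
  have hbb : ∀ m n, |b m * b n| ≤ 4 := by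
    intro m n
    rw [abs_mul]
    calc |b m| * |b n| ≤ 2 * 2 := by gcongr <;> exact hb _
      _ = 4 := by norm_num
  have hdiag : ∀ k, b k * b k * I k k ≤
      4 * ((Y - X) * (Real.exp (-(α / 2)) * Real.exp (-(α * ((k : ℝ) + 1) ^ 2)))) := by
    intro k
    have hI : |I k k| ≤ (Y - X) * (Real.exp (-(α / 2)) * Real.exp (-(α * ((k : ℝ) + 1) ^ 2))) := by
      have := intervalIntegral.norm_integral_le_of_norm_le_const (a := X) (b := Y)
        (C := Real.exp (-(α / 2)) * Real.exp (-(α * ((k : ℝ) + 1) ^ 2)))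
        (f := fun x : ℝ => (Complex.exp (-((((l k + l k) * p : ℝ) : ℂ) +
          (((l k - l k) * q : ℝ) : ℂ) * Complex.I) * x)).re) ?_
      · rw [Real.norm_eq_abs, abs_of_nonneg (by linarith : 0 ≤ Y - X), mul_comm _ (Y - X)] at this
        exact this
      · intro x hx
        rw [Set.uIoc_of_le hXY] at hx
        refine (Complex.abs_re_le_norm _).trans ?_
        rw [Complex.norm_exp, ← Real.exp_add]
        apply Real.exp_le_exp.mpr
        simp only [sub_self, zero_mul, Complex.ofReal_zero, add_zero, ← Complex.ofReal_neg,
          ← Complex.ofReal_mul, Complex.ofReal_re]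
        have h1 : 1 ≤ l k := by
          simp only [hl]
          have : (0 : ℝ) ≤ k := k.cast_nonneg
          nlinarith
        have h2 : α ≤ p * x := by
          rw [hα]
          gcongr
          exact hx.1.le
        change -((l k + l k) * p) * x ≤ -(α / 2) + -(α * l k)
        have : l k * α ≤ l k * (p * x) := by gcongr
        nlinarith
    calc b k * b k * I k k ≤ |b k * b k| * |I k k| := by
          rw [← abs_mul]; exact le_abs_self _
      _ ≤ _ := by gcongr; exact hbb k k
  have hoff : ∀ k, ∑ m ∈ Finset.range k, (b m * b k * I m k + b k * b m * I k m) ≤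
      128 * (Real.exp (-(α / 2)) *
        (Real.exp (-(α / 2 * ((k : ℝ) + 1) ^ 2)) * ((k : ℝ) + 1) ^ (-(1 / 2) : ℝ))) := by
    intro k
    have hk0 : (0 : ℝ) < k + 1 := by positivity
    set E := Real.exp (-(α / 2)) * Real.exp (-(α / 2 * ((k : ℝ) + 1) ^ 2)) with hE
    have hE0 : 0 < E := by positivity
    have hI : ∀ m n : ℕ, m ≠ n → k ≤ max m n → ∀ m' : ℕ, m' < k → m' = min m n → max m n = k →
        b m * b n * I m n ≤ 32 * E * ((1 / (k - m')) / (k + 1)) := by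
      intro m n hmn _ m' hm' hmin hmax
      have hdiff : ((k : ℝ) - m') * (k + 1) ≤ |l m - l n| := by
        have hkm : (m' : ℝ) < k := by exact_mod_cast hm'
        have hm0 : (0 : ℝ) ≤ m' := m'.cast_nonneg
        have : |l m - l n| = l k - l m' := by
          have hpos : 0 ≤ l k - l m' := by simp only [hl]; nlinarith
          rcases le_total m n with h | h
          · rw [max_eq_right h] at hmax
            rw [min_eq_left h] at hmin
            rw [hmax, ← hmin, abs_sub_comm, abs_of_nonneg hpos]
          · rw [max_eq_left h] at hmax
            rw [min_eq_right h] at hmin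
            rw [hmax, ← hmin, abs_of_nonneg hpos]
        rw [this]
        simp only [hl]
        nlinarith
      have hkm : (0 : ℝ) < k - m' := by
        have : (m' : ℝ) < k := by exact_mod_cast hm'
        linarith
      have hpos : 0 < |l m - l n| := lt_of_lt_of_le (by positivity) hdiff
      have hβ : (l m - l n) * q ≠ 0 := mul_ne_zero (abs_pos.mp hpos) hq0.ne'
      have h0 : ∀ n, 0 ≤ l n := fun n => by positivity
      have h1 := abs_integral_re_exp_le (α := (l m + l n) * p) (β := (l m - l n) * q)
        (by have := h0 m; have := h0 n; positivity) hβ hXY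
      have hsumle : α / 2 + α / 2 * ((k : ℝ) + 1) ^ 2 ≤ (l m + l n) * p * X := by
        have hlk : l k ≤ l m + l n := by
          rcases le_total m n with h | h
          · rw [max_eq_right h] at hmax
            rw [← hmax]; linarith [h0 m]
          · rw [max_eq_left h] at hmax
            rw [← hmax]; linarith [h0 n]
        have h1k : 1 ≤ l k := by
          simp only [hl]
          have : (0 : ℝ) ≤ k := k.cast_nonneg
          nlinarith
        rw [mul_assoc, ← hα]
        change α / 2 + α / 2 * l k ≤ _
        nlinarith
      have h2 : |I m n| ≤ 8 * E * ((1 / (k - m')) / (k + 1)) := by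
        refine h1.trans ?_
        rw [abs_mul, abs_of_pos hq0]
        have : Real.exp (-((l m + l n) * p * X)) ≤ E := by
          rw [hE, ← Real.exp_add]
          apply Real.exp_le_exp.mpr
          linarith
        calc 2 * Real.exp (-((l m + l n) * p * X)) / (|l m - l n| * q)
            ≤ 2 * E / (((k - m') * (k + 1)) * (1 / 4)) := by gcongr
          _ = _ := by field_simp; norm_num
      calc b m * b n * I m n ≤ |b m * b n| * |I m n| := by
            rw [← abs_mul]; exact le_abs_self _
        _ ≤ 4 * (8 * E * ((1 / (k - m')) / (k + 1))) := by gcongr; exact hbb m n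
        _ = _ := by ring
    calc ∑ m ∈ Finset.range k, (b m * b k * I m k + b k * b m * I k m)
        ≤ ∑ m ∈ Finset.range k, (64 * E / (k + 1)) * (1 / ((k : ℝ) - m)) := by
          refine Finset.sum_le_sum fun m hm => ?_
          have hm' := Finset.mem_range.mp hm
          have e1 := hI m k hm'.ne (le_max_right _ _) m hm' (by simp [hm'.le]) (by simp [hm'.le])
          have e2 := hI k m hm'.ne' (le_max_left _ _) m hm' (by simp [hm'.le]) (by simp [hm'.le])
          calc _ ≤ _ := add_le_add e1 e2
            _ = _ := by ring
      _ = (64 * E / (k + 1)) * ∑ m ∈ Finset.range k, 1 / ((k : ℝ) - m) := by rw [Finset.mul_sum]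
      _ ≤ (64 * E / (k + 1)) * (2 * √((k : ℝ) + 1)) := by
          gcongr
          refine (sum_inv_sub_le k).trans ?_
          gcongr
          linarith
      _ = 128 * (E * ((k : ℝ) + 1) ^ (-(1 / 2) : ℝ)) := by
          rw [Real.rpow_neg hk0.le, ← Real.sqrt_eq_rpow]
          have h4 : √((k : ℝ) + 1) ^ 2 = k + 1 := Real.sq_sqrt hk0.le
          have h5 : 0 < √((k : ℝ) + 1) := Real.sqrt_pos.mpr hk0
          field_simp
          rw [h4]
          ring
      _ = _ := by rw [hE]; ring
  calc ∑ k ∈ Finset.range N, (b k * b k * I k k +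
        ∑ m ∈ Finset.range k, (b m * b k * I m k + b k * b m * I k m))
      ≤ ∑ k ∈ Finset.range N, (4 * ((Y - X) * (Real.exp (-(α / 2)) *
          Real.exp (-(α * ((k : ℝ) + 1) ^ 2)))) + 128 * (Real.exp (-(α / 2)) *
        (Real.exp (-(α / 2 * ((k : ℝ) + 1) ^ 2)) * ((k : ℝ) + 1) ^ (-(1 / 2) : ℝ)))) :=
        Finset.sum_le_sum fun k _ => add_le_add (hdiag k) (hoff k)
    _ = Real.exp (-(α / 2)) * (4 * (Y - X) * ∑ k ∈ Finset.range N,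
          Real.exp (-(α * ((k : ℝ) + 1) ^ 2)) + 128 * ∑ k ∈ Finset.range N,
          Real.exp (-(α / 2 * ((k : ℝ) + 1) ^ 2)) * ((k : ℝ) + 1) ^ (-(1 / 2) : ℝ)) := by
        rw [Finset.sum_add_distrib, ← Finset.mul_sum, ← Finset.mul_sum, ← Finset.mul_sum,
          ← Finset.mul_sum, ← Finset.mul_sum]
        ring
    _ ≤ Real.exp (-(α / 2)) * (4 * (Y - X) * α ^ (-(1 / 2) : ℝ) +
          128 * (C₀ * (α / 2) ^ (-(3 / 8) : ℝ))) := by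
        have h1 := sum_exp_neg_sq_le hα0 N
        have h2 := hsum (α / 2) (by positivity) N
        have : 0 ≤ Y - X := by linarith
        gcongr
    _ ≤ _ := by
        have h1 : (α / 2) ^ (-(3 / 8) : ℝ) = (2 : ℝ) ^ (3 / 8 : ℝ) * α ^ (-(3 / 8) : ℝ) := by
          rw [Real.div_rpow hα0.le (by norm_num), Real.rpow_neg (by norm_num : (0 : ℝ) ≤ 2)]
          field_simp
        rw [h1, mul_comm _ (Real.exp _), mul_assoc (Real.exp _)]
        gcongr
        have h2 : 0 ≤ (Y - X) * α ^ (-(1 / 2) : ℝ) := by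
          have : 0 ≤ Y - X := by linarith
          positivity
        have h3 : 0 ≤ α ^ (-(3 / 8) : ℝ) := by positivity
        have h4 : 0 ≤ C₀ * (2 : ℝ) ^ (3 / 8 : ℝ) := by positivity
        nlinarith [mul_nonneg h4 h2]

/-- The coefficients of `(1 - 2⁻ˢ) (1 - 2¹⁻ˢ) ζ(s)` as a Dirichlet series, indexed from zero. -/
noncomputable def twistCoeff (n : ℕ) : ℝ :=
  1 - 3 * (if 2 ∣ n + 1 then 1 else 0) + 2 * (if 4 ∣ n + 1 then 1 else 0)

theorem twistCoeff_zero : twistCoeff 0 = 1 := by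
  norm_num [twistCoeff]

theorem abs_twistCoeff_le (n : ℕ) : |twistCoeff n| ≤ 2 := by
  unfold twistCoeff
  have : 4 ∣ n + 1 → 2 ∣ n + 1 := fun h => dvd_trans (by norm_num) h
  by_cases h2 : 2 ∣ n + 1 <;> by_cases h4 : 4 ∣ n + 1
  · simp [h2, h4]; norm_num
  · simp [h2, h4]; norm_num
  · exact absurd (this h4) h2
  · simp [h2, h4]

theorem HasSum.ite_dvd_succ {f : ℕ → ℂ} {a : ℂ} {k : ℕ} (hk : 0 < k)
    (h : HasSum (fun n => f (k * (n + 1))) a) :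
    HasSum (fun n => if k ∣ n + 1 then f (n + 1) else 0) a := by
  have hinj : Function.Injective fun n : ℕ => k * (n + 1) - 1 := by
    intro m n hmn
    have h1 : 0 < k * (m + 1) := by positivity
    have h2 : 0 < k * (n + 1) := by positivity
    have h3 : k * (m + 1) = k * (n + 1) := by
      simp only at hmn
      omega
    have := Nat.eq_of_mul_eq_mul_left hk h3
    omega
  refine (hinj.hasSum_iff ?_).mp ?_
  · intro n hn
    rw [if_neg]
    rintro ⟨c, hc⟩
    refine hn ⟨c - 1, ?_⟩
    have : c ≠ 0 := by rintro rfl; omega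
    simp only
    rw [Nat.sub_add_cancel (by omega)]
    omega
  · convert h using 1
    ext n
    have : k * (n + 1) - 1 + 1 = k * (n + 1) := Nat.sub_add_cancel (Nat.mul_pos hk n.succ_pos)
    simp [this]

theorem HasSum.twistCoeff_mul {f : ℕ → ℂ} {a b c : ℂ} (h1 : HasSum (fun n => f (n + 1)) a)
    (h2 : HasSum (fun n => f (2 * (n + 1))) b) (h4 : HasSum (fun n => f (4 * (n + 1))) c) :
    HasSum (fun n => (twistCoeff n : ℂ) * f (n + 1)) (a - 3 * b + 2 * c) := by
  have h := (h1.sub ((h2.ite_dvd_succ two_pos).mul_left 3)).add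
    ((h4.ite_dvd_succ four_pos).mul_left 2)
  refine h.congr_fun fun n => ?_
  rw [twistCoeff]
  split_ifs <;> push_cast <;> ring

/-- The theta series `∑ b(n) exp (-π n² z / 4)` attached to `(1 - 2⁻ˢ) (1 - 2¹⁻ˢ) ζ(s)`. -/
noncomputable def twistTheta (z : ℂ) : ℂ :=
  (jacobiTheta (Complex.I * (z / 4)) - 3 * jacobiTheta (Complex.I * z) +
    2 * jacobiTheta (Complex.I * (4 * z))) / 2

theorem hasSum_twistTheta {z : ℂ} (hz : 0 < z.re) :
    HasSum (fun n : ℕ => (twistCoeff n : ℂ) *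
      Complex.exp (-(Real.pi / 4 * ((n : ℂ) + 1) ^ 2 * z))) (twistTheta z) := by
  have key : ∀ w : ℂ, 0 < w.re → HasSum (fun n : ℕ => Complex.exp (-(Real.pi * ((n : ℂ) + 1) ^ 2 * w)))
      ((jacobiTheta (Complex.I * w) - 1) / 2) := by
    intro w hw
    convert hasSum_nat_jacobiTheta (τ := Complex.I * w) (by simpa using hw) using 3 with n
    linear_combination (-Real.pi * ((n : ℂ) + 1) ^ 2 * w) * Complex.I_mul_I
  have h1 := key (z / 4) (by simpa using hz)
  have h2 := key z hz
  have h4 := key (4 * z) (by simpa using hz)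
  convert HasSum.twistCoeff_mul (f := fun n => Complex.exp (-(Real.pi / 4 * (n : ℂ) ^ 2 * z)))
    (a := (jacobiTheta (Complex.I * (z / 4)) - 1) / 2)
    (b := (jacobiTheta (Complex.I * z) - 1) / 2)
    (c := (jacobiTheta (Complex.I * (4 * z)) - 1) / 2) ?_ ?_ ?_ using 1
  · ext n; push_cast; rfl
  · unfold twistTheta; ring
  · convert h1 using 3 with n; push_cast; ring
  · convert h2 using 3 with n; push_cast; ring
  · convert h4 using 3 with n; push_cast; ring

theorem twistTheta_conj {z : ℂ} (hz : 0 < z.re) :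
    twistTheta ((starRingEnd ℂ) z) = (starRingEnd ℂ) (twistTheta z) := by
  refine (hasSum_twistTheta (by simpa using hz)).unique ?_
  convert (hasSum_twistTheta hz).map (starRingEnd ℂ) Complex.continuous_conj using 1
  ext n
  have h4 : (starRingEnd ℂ) (4 : ℂ) = 4 := Complex.conj_ofNat 4
  simp [← Complex.exp_conj, h4]

theorem twistTheta_exp_neg {ζ : ℂ} (h1 : -(Real.pi / 2) < ζ.im) (h2 : ζ.im < Real.pi / 2) :
    twistTheta (Complex.exp (-ζ)) = Complex.exp (ζ / 2) * twistTheta (Complex.exp ζ) := by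
  have key : ∀ r : ℝ, jacobiTheta (Complex.I * (Complex.exp (-(ζ + r)))) =
      Complex.exp ((ζ + r) / 2) * jacobiTheta (Complex.I * Complex.exp (ζ + r)) := by
    intro r
    have hpos : 0 < (Complex.I * Complex.exp (ζ + r)).im := by
      simp only [Complex.mul_im, Complex.I_re, Complex.I_im, Complex.exp_re]
      have := Real.cos_pos_of_mem_Ioo ⟨h1, h2⟩
      simp only [Complex.add_im, Complex.ofReal_im, add_zero, zero_mul, zero_add, one_mul]
      positivity
    have := jacobiTheta_S_smul ⟨_, hpos⟩
    rw [UpperHalfPlane.modular_S_smul] at this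
    simp only at this
    have e1 : -Complex.I * (Complex.I * Complex.exp (ζ + r)) = Complex.exp (ζ + r) := by
      linear_combination (-Complex.exp (ζ + r)) * Complex.I_mul_I
    have e2 : (-(Complex.I * Complex.exp (ζ + r)))⁻¹ = Complex.I * Complex.exp (-(ζ + r)) := by
      rw [inv_neg, mul_inv, Complex.inv_I, Complex.exp_neg]
      ring
    rw [e1, e2] at this
    rw [this, Complex.cpow_def_of_ne_zero (Complex.exp_ne_zero _), Complex.log_exp]
    · congr 2; ring
    · simp; linarith [Real.pi_pos]
    · simp; linarith [Real.pi_pos]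
  have hlog : Complex.exp ((Real.log 4 : ℝ) : ℂ) = 4 := by
    rw [← Complex.ofReal_exp, Real.exp_log (by norm_num)]; norm_num
  have hlog2 : Complex.exp (((Real.log 4 : ℝ) : ℂ) / 2) = 2 := by
    rw [← Complex.ofReal_ofNat, ← Complex.ofReal_div, ← Complex.ofReal_exp]
    have : Real.log 4 / 2 = Real.log 2 := by
      rw [show (4 : ℝ) = 2 ^ 2 by norm_num, Real.log_pow]; push_cast; ring
    rw [this, Real.exp_log (by norm_num)]
  have k0 := key 0
  have k1 := key (Real.log 4)
  have k2 := key (-Real.log 4)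
  simp only [Complex.ofReal_zero, add_zero] at k0
  rw [neg_add, Complex.exp_add, Complex.exp_neg (Real.log 4 : ℂ), add_div, Complex.exp_add (ζ / 2),
    Complex.exp_add ζ, hlog, hlog2] at k1
  rw [neg_add, Complex.exp_add, add_div, Complex.exp_add (ζ / 2), Complex.exp_add ζ,
    Complex.ofReal_neg, neg_neg, neg_div, Complex.exp_neg (Real.log 4 : ℂ),
    Complex.exp_neg ((Real.log 4 : ℂ) / 2), hlog, hlog2] at k2
  unfold twistTheta
  rw [div_eq_mul_inv (Complex.exp (-ζ)), k0, k1, mul_comm 4 (Complex.exp (-ζ)), k2,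
    mul_comm 4 (Complex.exp ζ), div_eq_mul_inv (Complex.exp ζ)]
  ring

theorem exists_norm_twistTheta_le (j : ℕ) (hj : j ≠ 0) :
    ∃ C : ℝ, ∀ z : ℂ, 0 < z.re → ‖twistTheta z‖ ≤ C * (z.re ^ j)⁻¹ := by
  have hs : Summable fun n : ℕ => 2 * (j.factorial : ℝ) * ((4 / Real.pi) ^ j) *
      (1 / ((n : ℝ) + 1) ^ (2 * j)) := by
    have := (summable_nat_add_iff 1).mpr
      (Real.summable_one_div_nat_pow.mpr (by omega : 1 < 2 * j))
    refine Summable.mul_left _ ?_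
    simpa using this
  refine ⟨∑' n : ℕ, 2 * (j.factorial : ℝ) * ((4 / Real.pi) ^ j) * (1 / ((n : ℝ) + 1) ^ (2 * j)),
    fun z hz => ?_⟩
  rw [← (hasSum_twistTheta hz).tsum_eq]
  rw [← tsum_mul_right]
  refine tsum_of_norm_bounded (hs.mul_right _).hasSum fun n => ?_
  rw [norm_mul, Complex.norm_real, Real.norm_eq_abs, Complex.norm_exp]
  have hre : (-(Real.pi / 4 * ((n : ℂ) + 1) ^ 2 * z)).re =
      -(Real.pi / 4 * ((n : ℝ) + 1) ^ 2 * z.re) := by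
    have : (Real.pi / 4 * ((n : ℂ) + 1) ^ 2) = ((Real.pi / 4 * ((n : ℝ) + 1) ^ 2 : ℝ) : ℂ) := by
      push_cast; ring
    rw [this, Complex.neg_re, Complex.re_ofReal_mul]
  rw [hre]
  set y := Real.pi / 4 * ((n : ℝ) + 1) ^ 2 * z.re with hy
  have hy0 : 0 < y := by positivity
  have h1 : Real.exp (-y) ≤ j.factorial / y ^ j := by
    have := Real.pow_div_factorial_le_exp (x := y) hy0.le j
    rw [Real.exp_neg, inv_eq_one_div, div_le_div_iff₀ (Real.exp_pos _) (by positivity)]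
    rw [div_le_iff₀ (by positivity)] at this
    linarith
  calc |twistCoeff n| * Real.exp (-y) ≤ 2 * (j.factorial / y ^ j) := by
        gcongr; exact abs_twistCoeff_le n
    _ = _ := by
        rw [hy]
        simp only [mul_pow, div_pow, ← pow_mul]
        field_simp

theorem continuousOn_twistTheta : ContinuousOn twistTheta {z | 0 < z.re} := by
  intro z hz
  have hz' : 0 < z.re := hz
  have key : ∀ c : ℂ, 0 < (c * z).re →
      ContinuousAt (fun z => jacobiTheta (Complex.I * (c * z))) z := by
    intro c hc
    refine ContinuousAt.comp (g := jacobiTheta) (f := fun z => Complex.I * (c * z))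
      (continuousAt_jacobiTheta ?_) (by fun_prop)
    simpa using hc
  have h1 := key 1 (by simpa using hz')
  have h4 := key 4 (by simpa using hz')
  have h14 := key 4⁻¹ (by simpa using hz')
  simp only [one_mul] at h1
  apply ContinuousAt.continuousWithinAt
  unfold twistTheta
  have h : ∀ z : ℂ, z / 4 = 4⁻¹ * z := fun z => by ring
  simp_rw [h]
  fun_prop

/-- The normalised theta series along the ray of argument `α`, in logarithmic coordinates. -/
noncomputable def twistKernel (α u : ℝ) : ℂ :=
  Complex.exp ((α * Complex.I - u) / 4) * twistTheta (Complex.exp (α * Complex.I - u))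

theorem re_exp_mul_I_sub (α u : ℝ) :
    (Complex.exp (α * Complex.I - u)).re = Real.exp (-u) * Real.cos α := by
  rw [Complex.exp_re]
  simp

theorem twistKernel_neg {α : ℝ} (h1 : -(Real.pi / 2) < α) (h2 : α < Real.pi / 2) (u : ℝ) :
    twistKernel α (-u) = (starRingEnd ℂ) (twistKernel α u) := by
  have hc := Real.cos_pos_of_mem_Ioo ⟨h1, h2⟩
  unfold twistKernel
  have hconj : (starRingEnd ℂ) (α * Complex.I - u) = -(α * Complex.I + u) := by
    simp; ring
  have := twistTheta_exp_neg (ζ := α * Complex.I + u) (by simpa using h1) (by simpa using h2)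
  rw [map_mul, ← Complex.exp_conj, ← twistTheta_conj, ← Complex.exp_conj, map_div₀, hconj, this,
    ← mul_assoc, ← Complex.exp_add]
  · have h4 : (starRingEnd ℂ) (4 : ℂ) = 4 := Complex.conj_ofNat 4
    rw [h4]
    push_cast
    rw [sub_neg_eq_add]
    congr 2
    ring
  · rw [re_exp_mul_I_sub]; positivity

theorem norm_twistKernel_neg {α : ℝ} (h1 : -(Real.pi / 2) < α) (h2 : α < Real.pi / 2) (u : ℝ) :
    ‖twistKernel α (-u)‖ = ‖twistKernel α u‖ := by
  rw [twistKernel_neg h1 h2, Complex.norm_conj]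

theorem norm_twistKernel (α u : ℝ) :
    ‖twistKernel α u‖ = Real.exp (-(u / 4)) * ‖twistTheta (Complex.exp (α * Complex.I - u))‖ := by
  unfold twistKernel
  rw [norm_mul, Complex.norm_exp]
  congr 2
  simp
  ring

theorem continuous_twistKernel {α : ℝ} (h1 : -(Real.pi / 2) < α) (h2 : α < Real.pi / 2) :
    Continuous (twistKernel α) := by
  unfold twistKernel
  refine Continuous.mul (by fun_prop) ?_
  refine continuousOn_twistTheta.comp_continuous (by fun_prop) fun u => ?_
  have hc := Real.cos_pos_of_mem_Ioo ⟨h1, h2⟩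
  change 0 < (Complex.exp (α * Complex.I - u)).re
  rw [re_exp_mul_I_sub]
  positivity

theorem exists_norm_twistKernel_le {α : ℝ} (h1 : -(Real.pi / 2) < α) (h2 : α < Real.pi / 2)
    (k : ℕ) : ∃ C : ℝ, 0 ≤ C ∧ ∀ u : ℝ, ‖twistKernel α u‖ ≤ C * Real.exp (-(k * |u|)) := by
  obtain ⟨C, hC⟩ := exists_norm_twistTheta_le (k + 1) (by omega)
  have hc := Real.cos_pos_of_mem_Ioo ⟨h1, h2⟩
  have hneg : ∀ u : ℝ, u ≤ 0 → ‖twistKernel α u‖ ≤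
      |C| * (Real.cos α ^ (k + 1))⁻¹ * Real.exp (-(k * |u|)) := by
    intro u hu
    rw [norm_twistKernel, abs_of_nonpos hu]
    have := hC (Complex.exp (α * Complex.I - u)) (by rw [re_exp_mul_I_sub]; positivity)
    rw [re_exp_mul_I_sub] at this
    calc _ ≤ Real.exp (-(u / 4)) * (C * ((Real.exp (-u) * Real.cos α) ^ (k + 1))⁻¹) := by gcongr
      _ ≤ Real.exp (-(u / 4)) * (|C| * ((Real.exp (-u) * Real.cos α) ^ (k + 1))⁻¹) := by
          gcongr; exact le_abs_self C
      _ = |C| * (Real.cos α ^ (k + 1))⁻¹ *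
          Real.exp (-(u / 4) + -((k + 1 : ℕ) * (-u))) := by
          rw [mul_pow, ← Real.exp_nat_mul, mul_inv, ← Real.exp_neg, Real.exp_add]
          ring
      _ ≤ _ := by
          gcongr
          push_cast
          nlinarith
  refine ⟨|C| * (Real.cos α ^ (k + 1))⁻¹, by positivity, fun u => ?_⟩
  rcases le_total u 0 with hu | hu
  · exact hneg u hu
  · rw [← norm_twistKernel_neg h1 h2, ← abs_neg u]
    exact hneg (-u) (by linarith)

theorem integrable_exp_mul_twistKernel {α : ℝ} (h1 : -(Real.pi / 2) < α) (h2 : α < Real.pi / 2)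
    (c : ℝ) : MeasureTheory.Integrable fun u : ℝ => (Real.exp (c * u) : ℂ) * twistKernel α u := by
  obtain ⟨k, hk⟩ := exists_nat_ge (|c| + 1)
  obtain ⟨C, hC0, hC⟩ := exists_norm_twistKernel_le h1 h2 k
  have hint : MeasureTheory.Integrable fun u : ℝ => C * Real.exp (-|u|) := by
    refine MeasureTheory.Integrable.const_mul ?_ C
    refine (integrable_inv_one_add_sq.const_mul 2).mono'
      (by fun_prop) (Filter.Eventually.of_forall fun u => ?_)
    have h := Real.quadratic_le_exp_of_nonneg (abs_nonneg u)
    rw [sq_abs] at h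
    rw [Real.norm_eq_abs, Real.abs_exp, Real.exp_neg, ← div_eq_mul_inv, inv_eq_one_div,
      div_le_div_iff₀ (Real.exp_pos _) (by positivity)]
    nlinarith [abs_nonneg u]
  refine hint.mono' ?_ (Filter.Eventually.of_forall fun u => ?_)
  · have := continuous_twistKernel h1 h2
    exact (by fun_prop : Continuous _).aestronglyMeasurable
  · rw [norm_mul, Complex.norm_real, Real.norm_eq_abs, Real.abs_exp]
    calc Real.exp (c * u) * ‖twistKernel α u‖ ≤ Real.exp (c * u) * (C * Real.exp (-(k * |u|))) := by
          gcongr; exact hC u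
      _ = C * Real.exp (c * u - k * |u|) := by rw [sub_eq_add_neg, Real.exp_add]; ring
      _ ≤ _ := by
          gcongr
          have h3 : c * u ≤ |c| * |u| := by rw [← abs_mul]; exact le_abs_self _
          nlinarith [abs_nonneg u]

open MeasureTheory Set in
theorem integrableOn_cpow_mul_exp_neg_mul {a r : ℂ} (ha : 0 < a.re) (hr : 0 < r.re) :
    IntegrableOn (fun t : ℝ => (t : ℂ) ^ (a - 1) * Complex.exp (-(r * t))) (Ioi 0) := by
  refine Integrable.mono' (integrableOn_rpow_mul_exp_neg_mul_rpow (p := 1) (s := a.re - 1)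
    (b := r.re) (by linarith) one_pos hr) ?_ ?_
  · refine ContinuousOn.aestronglyMeasurable (fun t ht => ContinuousAt.continuousWithinAt ?_)
      measurableSet_Ioi
    refine ContinuousAt.mul (Complex.continuousAt_ofReal_cpow_const _ _ (Or.inr ht.ne')) ?_
    fun_prop
  · filter_upwards [ae_restrict_mem measurableSet_Ioi] with t ht
    rw [norm_mul, Complex.norm_cpow_eq_rpow_re_of_pos ht, Complex.norm_exp]
    simp

open MeasureTheory Set in
theorem Complex.integral_cpow_mul_exp_neg_mul {a r : ℂ} (ha : 0 < a.re) (hr : 0 < r.re) :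
    ∫ t : ℝ in Ioi 0, (t : ℂ) ^ (a - 1) * Complex.exp (-(r * t)) = r ^ (-a) * Complex.Gamma a := by
  set U : Set ℂ := {z | 0 < z.re}
  have hU : IsOpen U := isOpen_lt continuous_const Complex.continuous_re
  have hd1 : DifferentiableOn ℂ
      (fun r : ℂ => ∫ t : ℝ in Ioi 0, (t : ℂ) ^ (a - 1) * Complex.exp (-(r * t))) U := by
    intro r (hr : 0 < r.re)
    have hball : ∀ x ∈ Metric.ball r (r.re / 2), r.re / 2 < x.re := by
      intro x hx
      have h1 := Complex.abs_re_le_norm (x - r)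
      rw [Metric.mem_ball, dist_eq_norm] at hx
      have := abs_lt.mp (h1.trans_lt hx)
      rw [Complex.sub_re] at this
      linarith [this.1]
    have := hasDerivAt_integral_of_dominated_loc_of_deriv_le
      (F := fun (r : ℂ) (t : ℝ) => (t : ℂ) ^ (a - 1) * Complex.exp (-(r * t)))
      (F' := fun (r : ℂ) (t : ℝ) => (t : ℂ) ^ (a - 1) * (Complex.exp (-(r * t)) * (-t)))
      (μ := volume.restrict (Ioi 0)) (x₀ := r)
      (bound := fun t => t ^ a.re * Real.exp (-(r.re / 2) * t ^ (1 : ℝ)))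
      (Metric.ball_mem_nhds r (half_pos hr)) ?_ (integrableOn_cpow_mul_exp_neg_mul ha hr) ?_ ?_
      (integrableOn_rpow_mul_exp_neg_mul_rpow (by linarith) one_pos (half_pos hr)) ?_
    · exact this.2.differentiableAt.differentiableWithinAt
    · filter_upwards [Metric.ball_mem_nhds r (half_pos hr)] with x hx
      exact (integrableOn_cpow_mul_exp_neg_mul ha ((half_pos hr).trans (hball x hx))).1
    · refine ContinuousOn.aestronglyMeasurable (fun t ht => ContinuousAt.continuousWithinAt ?_)
        measurableSet_Ioi
      refine ContinuousAt.mul (Complex.continuousAt_ofReal_cpow_const _ _ (Or.inr ht.ne')) ?_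
      fun_prop
    · filter_upwards [ae_restrict_mem measurableSet_Ioi] with t ht x hx
      have ht0 : 0 < t := ht
      rw [norm_mul, norm_mul, Complex.norm_cpow_eq_rpow_re_of_pos ht, Complex.norm_exp, norm_neg,
        Complex.norm_real, Real.norm_eq_abs, abs_of_pos ht0, Real.rpow_one, Complex.sub_re,
        Complex.one_re, mul_comm (Real.exp _), ← mul_assoc, Real.rpow_sub_one ht0.ne',
        div_mul_cancel₀ _ ht0.ne']
      gcongr
      simp
      gcongr
      exact (hball x hx).le
    · refine Filter.Eventually.of_forall fun t x _ => ?_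
      refine HasDerivAt.const_mul _ ?_
      refine HasDerivAt.cexp ?_
      simpa using ((hasDerivAt_id x).mul_const (t : ℂ)).fun_neg
  have hd2 : DifferentiableOn ℂ (fun r : ℂ => r ^ (-a) * Complex.Gamma a) U := by
    intro r (hr : 0 < r.re)
    refine DifferentiableWithinAt.mul_const ?_ _
    exact (differentiableAt_id.cpow_const (Or.inl hr)).differentiableWithinAt
  refine (hd1.analyticOnNhd hU).eqOn_of_preconnected_of_frequently_eq (z₀ := 1)
    (hd2.analyticOnNhd hU) (convex_halfSpace_re_gt 0).isPreconnected (by simp [U]) ?_ hr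
  have htend : Filter.Tendsto (fun n : ℕ => ((1 + 1 / ((n : ℝ) + 1) : ℝ) : ℂ)) Filter.atTop
      (nhdsWithin 1 {1}ᶜ) := by
    refine tendsto_nhdsWithin_iff.mpr ⟨?_, Filter.Eventually.of_forall fun n => ?_⟩
    · have := (tendsto_one_div_add_atTop_nhds_zero_nat (𝕜 := ℝ)).const_add 1
      rw [add_zero] at this
      exact (Complex.continuous_ofReal.tendsto 1).comp this
    · have : (0 : ℝ) < 1 / ((n : ℝ) + 1) := by positivity
      intro h
      rw [mem_singleton_iff, ← Complex.ofReal_one, Complex.ofReal_inj] at h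
      linarith
  refine htend.frequently (Filter.Eventually.frequently (Filter.Eventually.of_forall fun n => ?_))
  have hpos : (0 : ℝ) < 1 + 1 / ((n : ℝ) + 1) := by positivity
  rw [Complex.integral_cpow_mul_exp_neg_mul_Ioi ha hpos, one_div, Complex.inv_cpow,
    Complex.cpow_neg]
  rw [Complex.arg_ofReal_of_nonneg hpos.le]
  exact Real.pi_pos.ne

/-- The Dirichlet series `∑ b(n) n⁻ˢ = (1 - 2⁻ˢ) (1 - 2¹⁻ˢ) ζ(s)`. -/
noncomputable def twistZeta (s : ℂ) : ℂ :=
  (1 - 3 * (2 : ℂ) ^ (-s) + 2 * (4 : ℂ) ^ (-s)) * riemannZeta s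

theorem hasSum_twistZeta {s : ℂ} (hs : 1 < s.re) :
    HasSum (fun n : ℕ => (twistCoeff n : ℂ) * ((n : ℂ) + 1) ^ (-s)) (twistZeta s) := by
  have h1 : HasSum (fun n : ℕ => ((n : ℂ) + 1) ^ (-s)) (riemannZeta s) := by
    have hsum : Summable fun n : ℕ => 1 / ((n : ℂ) + 1) ^ s := by
      have := (summable_nat_add_iff 1).mpr (Complex.summable_one_div_nat_cpow.mpr hs)
      simpa using this
    have := hsum.hasSum
    rw [← zeta_eq_tsum_one_div_nat_add_one_cpow hs] at this
    simpa [Complex.cpow_neg] using this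
  have hk : ∀ k : ℕ, HasSum (fun n : ℕ => ((k * (n + 1) : ℕ) : ℂ) ^ (-s))
      ((k : ℂ) ^ (-s) * riemannZeta s) := by
    intro k
    refine (h1.mul_left ((k : ℂ) ^ (-s))).congr_fun fun n => ?_
    rw [Nat.cast_mul, Complex.natCast_mul_natCast_cpow]
    push_cast
    rfl
  have := HasSum.twistCoeff_mul (f := fun n => (n : ℂ) ^ (-s)) (by simpa using h1) (hk 2) (hk 4)
  convert this using 1
  · ext n; push_cast; rfl
  · unfold twistZeta; push_cast; ring

theorem re_twistZeta_ge {t : ℝ} : 1 / 2 ≤ (twistZeta (3 + t * Complex.I)).re := by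
  have hs : (1 : ℝ) < (3 + t * Complex.I : ℂ).re := by simp
  have h := (hasSum_twistZeta hs)
  have h0 := (hasSum_nat_add_iff' 1).mpr h
  simp only [Finset.range_one, Finset.sum_singleton, twistCoeff_zero, Nat.cast_zero, zero_add,
    Complex.one_cpow, Complex.ofReal_one, mul_one] at h0
  have hb : HasSum (fun n : ℕ => 1 / (((n : ℝ) + 1) * (n + 2)) -
      1 / ((((n + 1 : ℕ) : ℝ) + 1) * ((n + 1 : ℕ) + 2))) (1 / 2) := by
    rw [hasSum_iff_tendsto_nat_of_nonneg]
    · simp_rw [Finset.sum_range_sub' (fun n : ℕ => 1 / (((n : ℝ) + 1) * (n + 2)))]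
      have h1 := tendsto_one_div_add_atTop_nhds_zero_nat (𝕜 := ℝ)
      have h2 : Filter.Tendsto (fun n : ℕ => 1 / (((n : ℝ) + 1) * (n + 2))) Filter.atTop
          (nhds 0) := by
        refine squeeze_zero (fun n => by positivity) (fun n => ?_) h1
        have : (0 : ℝ) ≤ n := n.cast_nonneg
        gcongr
        nlinarith
      simpa using h2.const_sub (1 / (((0 : ℕ) : ℝ) + 1) / ((0 : ℕ) + 2))
    · intro n
      rw [sub_nonneg]
      push_cast
      gcongr <;> linarith
  have hle := h0.norm_le_of_bounded hb fun n => ?_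
  · have h1 := (Complex.abs_re_le_norm _).trans hle
    rw [Complex.sub_re, Complex.one_re] at h1
    linarith [(abs_le.mp h1).1]
  · rw [norm_mul, Complex.norm_real, Real.norm_eq_abs]
    have hcast : (((n + 1 : ℕ) : ℂ) + 1) = (((n : ℝ) + 2 : ℝ) : ℂ) := by push_cast; ring
    have hpos : (0 : ℝ) < n + 2 := by positivity
    rw [hcast, Complex.norm_cpow_eq_rpow_re_of_pos hpos]
    have hre : (-(3 + t * Complex.I : ℂ)).re = -(3 : ℕ) := by simp
    rw [hre, Real.rpow_neg hpos.le, Real.rpow_natCast]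
    calc |twistCoeff (n + 1)| * (((n : ℝ) + 2) ^ 3)⁻¹ ≤ 2 * (((n : ℝ) + 2) ^ 3)⁻¹ := by
          gcongr
          exact abs_twistCoeff_le _
      _ ≤ 2 / (((n : ℝ) + 1) * (n + 2) * (n + 3)) := by
          rw [← div_eq_mul_inv]
          gcongr
          nlinarith
      _ = _ := by
          push_cast
          field_simp
          ring

/-- The theta series along a ray, as a function on the positive half line. -/
noncomputable def twistRay (α x : ℝ) : ℂ := twistTheta (Complex.exp (α * Complex.I) * x)

theorem twistRay_eq {α x : ℝ} (hx : 0 < x) : twistRay α x =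
    Complex.exp (-(α * Complex.I / 4)) * (x : ℂ) ^ (-(1 / 4) : ℂ) * twistKernel α (-Real.log x) := by
  have hx' : (x : ℂ) ≠ 0 := by exact_mod_cast hx.ne'
  have h1 : Complex.exp (α * Complex.I - (-Real.log x : ℝ)) = Complex.exp (α * Complex.I) * x := by
    rw [Complex.ofReal_neg, sub_neg_eq_add, Complex.exp_add, ← Complex.ofReal_exp, Real.exp_log hx]
  rw [twistKernel, h1, Complex.cpow_def_of_ne_zero hx', ← Complex.ofReal_log hx.le, ← mul_assoc,
    ← Complex.exp_add, ← Complex.exp_add, twistRay]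
  convert (one_mul _).symm
  rw [Complex.exp_eq_one_iff]
  exact ⟨0, by push_cast; ring⟩

theorem norm_twistRay {α x : ℝ} (hx : 0 < x) :
    ‖twistRay α x‖ = x ^ (-(1 / 4) : ℝ) * ‖twistKernel α (-Real.log x)‖ := by
  rw [twistRay_eq hx, norm_mul, norm_mul, Complex.norm_exp,
    Complex.norm_cpow_eq_rpow_re_of_pos hx]
  simp

theorem twistRay_exp_neg (α u : ℝ) : twistRay α (Real.exp (-u)) =
    Complex.exp (-(α * Complex.I / 4)) * Real.exp (u / 4) * twistKernel α u := by
  rw [twistRay_eq (Real.exp_pos _), Real.log_exp, neg_neg,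
    Complex.cpow_def_of_ne_zero (by exact_mod_cast (Real.exp_pos _).ne'),
    ← Complex.ofReal_log (Real.exp_pos _).le, Real.log_exp]
  congr 2
  push_cast
  congr 1
  ring

theorem mellin_twistRay (α : ℝ) (z : ℂ) : Complex.exp (α * Complex.I / 4) * mellin (twistRay α) z =
    FourierTransform.fourier (fun u : ℝ => (Real.exp (-(z.re - 1 / 4) * u) : ℂ) * twistKernel α u)
      (z.im / (2 * Real.pi)) := by
  rw [mellin_eq_fourier, Real.fourier_real_eq_integral_exp_smul, Real.fourier_real_eq_integral_exp_smul,
    ← MeasureTheory.integral_const_mul]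
  congr 1
  ext u
  rw [twistRay_exp_neg, smul_eq_mul, smul_eq_mul, Complex.real_smul]
  have h1 : (Real.exp (-(z.re - 1 / 4) * u) : ℂ) = Real.exp (-z.re * u) * Real.exp (u / 4) := by
    rw [← Complex.ofReal_mul, ← Real.exp_add]
    congr 2
    ring
  have h2 : Complex.exp (α * Complex.I / 4) * Complex.exp (-(α * Complex.I / 4)) = 1 := by
    rw [← Complex.exp_add, add_neg_cancel, Complex.exp_zero]
  rw [h1]
  linear_combination (Complex.exp (↑(-2 * Real.pi * u * (z.im / (2 * Real.pi))) * Complex.I) *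
    Real.exp (-z.re * u) * Real.exp (u / 4) * twistKernel α u) * h2

theorem continuousOn_twistRay {α : ℝ} (h1 : -(Real.pi / 2) < α) (h2 : α < Real.pi / 2) :
    ContinuousOn (twistRay α) (Set.Ioi 0) := by
  refine continuousOn_twistTheta.comp (by fun_prop) fun x hx => ?_
  have := Real.cos_pos_of_mem_Ioo ⟨h1, h2⟩
  have hx : 0 < x := hx
  simp only [Set.mem_ofPred_eq, Complex.re_mul_ofReal, Complex.exp_ofReal_mul_I_re]
  positivity

open Asymptotics Filter Topology in
theorem differentiableAt_mellin_twistRay {α : ℝ} (h1 : -(Real.pi / 2) < α) (h2 : α < Real.pi / 2)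
    {z : ℂ} (hz : 0 < z.re) : DifferentiableAt ℂ (mellin (twistRay α)) z := by
  obtain ⟨k, hk⟩ := exists_nat_gt (z.re + 1)
  obtain ⟨C, hC0, hC⟩ := exists_norm_twistKernel_le h1 h2 k
  refine mellin_differentiableAt_of_isBigO_rpow (a := k) (b := 0)
    ((continuousOn_twistRay h1 h2).locallyIntegrableOn measurableSet_Ioi) ?_ (by linarith) ?_ hz
  · refine IsBigO.of_bound C ?_
    filter_upwards [eventually_ge_atTop 1] with x hx
    have hx0 : 0 < x := by linarith
    rw [norm_twistRay hx0, Real.norm_of_nonneg (by positivity)]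
    have h3 := hC (-Real.log x)
    rw [abs_neg, abs_of_nonneg (Real.log_nonneg hx)] at h3
    have h4 : x ^ (-(1 / 4) : ℝ) ≤ 1 := Real.rpow_le_one_of_one_le_of_nonpos hx (by norm_num)
    have h5 : Real.exp (-(k * Real.log x)) = x ^ (-(k : ℝ)) := by
      rw [Real.rpow_def_of_pos hx0]; congr 1; ring
    calc _ ≤ 1 * (C * Real.exp (-(k * Real.log x))) := by gcongr
      _ = _ := by rw [h5, one_mul]
  · refine IsBigO.of_bound C ?_
    filter_upwards [Ioo_mem_nhdsGT (one_pos : (0 : ℝ) < 1)] with x hx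
    rw [norm_twistRay hx.1, neg_zero, Real.rpow_zero, norm_one, mul_one]
    have h3 := hC (-Real.log x)
    rw [abs_neg, abs_of_nonpos (Real.log_nonpos hx.1.le hx.2.le)] at h3
    have hx0 := hx.1
    calc _ ≤ x ^ (-(1 / 4) : ℝ) * (C * Real.exp (-(k * -Real.log x))) := by gcongr
      _ = C * Real.exp (Real.log x * (k - 1 / 4)) := by
        rw [Real.rpow_def_of_pos hx.1, mul_left_comm, ← Real.exp_add]
        congr 2
        ring
      _ ≤ C * 1 := by
        gcongr
        rw [Real.exp_le_one_iff]
        have := Real.log_nonpos hx.1.le hx.2.le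
        nlinarith
      _ = C := mul_one C

open MeasureTheory Set in
theorem mellin_twistRay_of_half_lt_re {α : ℝ} (h1 : -(Real.pi / 2) < α) (h2 : α < Real.pi / 2)
    {z : ℂ} (hz : 1 / 2 < z.re) : mellin (twistRay α) z =
    Complex.exp (-(α * Complex.I * z)) * ((Real.pi / 4 : ℝ) : ℂ) ^ (-z) * Complex.Gamma z *
      twistZeta (2 * z) := by
  have hz0 : 0 < z.re := by linarith
  have hcos := Real.cos_pos_of_mem_Ioo ⟨h1, h2⟩
  let r : ℕ → ℂ := fun n => Real.pi / 4 * ((n : ℂ) + 1) ^ 2 * Complex.exp (α * Complex.I)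
  have hr : ∀ n, (r n).re = Real.pi / 4 * ((n : ℝ) + 1) ^ 2 * Real.cos α := by
    intro n
    have : (Real.pi / 4 * ((n : ℂ) + 1) ^ 2) = ((Real.pi / 4 * ((n : ℝ) + 1) ^ 2 : ℝ) : ℂ) := by
      push_cast; ring
    simp only [r, this, Complex.re_ofReal_mul, Complex.exp_ofReal_mul_I_re]
  have hr0 : ∀ n, 0 < (r n).re := fun n => by rw [hr]; positivity
  let F : ℕ → ℝ → ℂ := fun n t => twistCoeff n * ((t : ℂ) ^ (z - 1) * Complex.exp (-(r n * t)))
  have hint : ∀ n, IntegrableOn (F n) (Ioi 0) := fun n =>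
    (integrableOn_cpow_mul_exp_neg_mul hz0 (hr0 n)).const_mul _
  have hnorm : ∀ n, ∫ t in Ioi 0, ‖F n t‖ =
      |twistCoeff n| * ((1 / (r n).re) ^ z.re * Real.Gamma z.re) := by
    intro n
    rw [← Real.integral_rpow_mul_exp_neg_mul_Ioi hz0 (hr0 n), ← integral_const_mul]
    refine setIntegral_congr_fun measurableSet_Ioi fun t ht => ?_
    simp only [F]
    rw [norm_mul, norm_mul, Complex.norm_real, Real.norm_eq_abs,
      Complex.norm_cpow_eq_rpow_re_of_pos ht, Complex.norm_exp]
    simp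
  have hsum : Summable fun n => ∫ t in Ioi 0, ‖F n t‖ := by
    have hs : Summable fun n : ℕ => 2 * ((1 / (Real.pi / 4 * Real.cos α)) ^ z.re *
        Real.Gamma z.re) * (1 / ((n : ℝ) + 1) ^ (2 * z.re)) := by
      refine Summable.mul_left _ ?_
      have := (summable_nat_add_iff 1).mpr
        (Real.summable_one_div_nat_rpow.mpr (by linarith : 1 < 2 * z.re))
      simpa using this
    refine hs.of_nonneg_of_le (fun n => by positivity) fun n => ?_
    have hG := Real.Gamma_pos_of_pos hz0
    rw [hnorm, hr]
    have h3 : (1 / (Real.pi / 4 * ((n : ℝ) + 1) ^ 2 * Real.cos α)) ^ z.re =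
        (1 / (Real.pi / 4 * Real.cos α)) ^ z.re * (1 / ((n : ℝ) + 1) ^ (2 * z.re)) := by
      rw [Real.rpow_mul (by positivity), Real.rpow_ofNat, ← Real.one_rpow z.re,
        ← Real.div_rpow (by norm_num) (by positivity), ← Real.mul_rpow (by positivity)
        (by positivity), Real.one_rpow]
      congr 1
      field_simp
    rw [h3]
    calc _ ≤ 2 * ((1 / (Real.pi / 4 * Real.cos α)) ^ z.re * (1 / ((n : ℝ) + 1) ^ (2 * z.re)) *
          Real.Gamma z.re) := by gcongr; exact abs_twistCoeff_le n
      _ = _ := by ring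
  have h3 := hasSum_integral_of_summable_integral_norm hint hsum
  have h4 : ∫ t in Ioi (0 : ℝ), ∑' n, F n t = mellin (twistRay α) z := by
    refine setIntegral_congr_fun measurableSet_Ioi fun t ht => ?_
    have ht0 : (0 : ℝ) < t := ht
    have h5 := hasSum_twistTheta (z := Complex.exp (α * Complex.I) * t)
      (by rw [Complex.re_mul_ofReal, Complex.exp_ofReal_mul_I_re]; positivity)
    rw [smul_eq_mul, twistRay, ← (h5.mul_left ((t : ℂ) ^ (z - 1))).tsum_eq]
    refine tsum_congr fun n => ?_
    simp only [F, r]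
    rw [mul_left_comm, ← mul_assoc (_ * _) _ (t : ℂ)]
  rw [h4] at h3
  refine h3.unique ?_
  have h6 := (hasSum_twistZeta (s := 2 * z) (by simp; linarith)).mul_left
    (Complex.exp (-(α * Complex.I * z)) * ((Real.pi / 4 : ℝ) : ℂ) ^ (-z) * Complex.Gamma z)
  refine h6.congr_fun fun n => ?_
  simp only [F]
  rw [integral_const_mul, Complex.integral_cpow_mul_exp_neg_mul hz0 (hr0 n)]
  have hn : (0 : ℝ) < n + 1 := by positivity
  have hπ : (0 : ℝ) < Real.pi / 4 := by positivity
  have hrn : r n = Complex.exp ((Real.log (Real.pi / 4) + 2 * Real.log (n + 1) : ℝ) +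
      α * Complex.I) := by
    rw [Complex.exp_add, ← Complex.ofReal_exp, Real.exp_add, Real.exp_log hπ, two_mul,
      Real.exp_add, Real.exp_log hn]
    simp only [r]
    push_cast
    ring
  have hne : r n ≠ 0 := fun h => (hr0 n).ne' (by rw [h]; rfl)
  have hlog : Complex.log (r n) = (Real.log (Real.pi / 4) + 2 * Real.log (n + 1) : ℝ) +
      α * Complex.I := by
    rw [hrn, Complex.log_exp]
    · simp; linarith [Real.pi_pos]
    · simp; linarith [Real.pi_pos]
  have hn' : ((n : ℂ) + 1) = ((n + 1 : ℝ) : ℂ) := by push_cast; rfl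
  have hn0 : ((n + 1 : ℝ) : ℂ) ≠ 0 := Complex.ofReal_ne_zero.mpr hn.ne'
  have hπ0 : ((Real.pi / 4 : ℝ) : ℂ) ≠ 0 := Complex.ofReal_ne_zero.mpr hπ.ne'
  rw [Complex.cpow_def_of_ne_zero hne, hlog, hn', Complex.cpow_def_of_ne_zero hn0,
    Complex.cpow_def_of_ne_zero hπ0, ← Complex.ofReal_log hn.le,
    ← Complex.ofReal_log hπ.le]
  have : Complex.exp (((Real.log (Real.pi / 4) + 2 * Real.log (n + 1) : ℝ) + α * Complex.I) * -z) =
      Complex.exp (-(α * Complex.I * z)) * Complex.exp (Real.log (Real.pi / 4) * -z) *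
        Complex.exp (Real.log (n + 1) * -(2 * z)) := by
    rw [← Complex.exp_add, ← Complex.exp_add]
    congr 1
    push_cast
    ring
  rw [this]
  ring

theorem differentiableAt_twistZeta {s : ℂ} (hs : s ≠ 1) : DifferentiableAt ℂ twistZeta s := by
  unfold twistZeta
  refine DifferentiableAt.mul ?_ (differentiableAt_riemannZeta hs)
  have h2 : DifferentiableAt ℂ (fun s : ℂ => (2 : ℂ) ^ (-s)) s :=
    differentiableAt_id.neg.const_cpow (Or.inl (by norm_num))
  have h4 : DifferentiableAt ℂ (fun s : ℂ => (4 : ℂ) ^ (-s)) s :=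
    differentiableAt_id.neg.const_cpow (Or.inl (by norm_num))
  fun_prop

theorem mellin_twistRay_eq {α : ℝ} (h1 : -(Real.pi / 2) < α) (h2 : α < Real.pi / 2)
    {z : ℂ} (hz : 0 < z.re) (hz' : 0 < z.im) : mellin (twistRay α) z =
    Complex.exp (-(α * Complex.I * z)) * ((Real.pi / 4 : ℝ) : ℂ) ^ (-z) * Complex.Gamma z *
      twistZeta (2 * z) := by
  set U : Set ℂ := {z | 0 < z.re} ∩ {z | 0 < z.im} with hU
  have hUo : IsOpen U := (isOpen_lt continuous_const Complex.continuous_re).inter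
    (isOpen_lt continuous_const Complex.continuous_im)
  have hUc : IsPreconnected U :=
    ((convex_halfSpace_re_gt 0).inter (convex_halfSpace_im_gt 0)).isPreconnected
  have hd1 : DifferentiableOn ℂ (mellin (twistRay α)) U := fun z hz =>
    (differentiableAt_mellin_twistRay h1 h2 hz.1).differentiableWithinAt
  have hd2 : DifferentiableOn ℂ (fun z => Complex.exp (-(α * Complex.I * z)) *
      ((Real.pi / 4 : ℝ) : ℂ) ^ (-z) * Complex.Gamma z * twistZeta (2 * z)) U := by
    intro z hz
    apply DifferentiableAt.differentiableWithinAt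
    have hπ : ((Real.pi / 4 : ℝ) : ℂ) ≠ 0 := by
      rw [Complex.ofReal_ne_zero]
      positivity
    have e1 : DifferentiableAt ℂ (fun z : ℂ => ((Real.pi / 4 : ℝ) : ℂ) ^ (-z)) z :=
      differentiableAt_id.neg.const_cpow (Or.inl hπ)
    have e2 : DifferentiableAt ℂ Complex.Gamma z := by
      refine Complex.differentiableAt_Gamma _ fun m h => ?_
      have := hz.2
      rw [h] at this
      simp at this
    have e3 : DifferentiableAt ℂ (fun z : ℂ => twistZeta (2 * z)) z := by
      refine DifferentiableAt.comp (g := twistZeta) z (differentiableAt_twistZeta ?_) (by fun_prop)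
      intro h
      have := congrArg Complex.im h
      have h3 : 0 < z.im := hz.2
      simp at this
      exact h3.ne' this
    fun_prop
  refine (hd1.analyticOnNhd hUo).eqOn_of_preconnected_of_eventuallyEq (z₀ := 1 + Complex.I)
    (hd2.analyticOnNhd hUo) hUc (by simp [hU]) ?_ ⟨hz, hz'⟩
  have hopen : IsOpen {z : ℂ | 1 / 2 < z.re} := isOpen_lt continuous_const Complex.continuous_re
  filter_upwards [hopen.mem_nhds (show (1 + Complex.I) ∈ {z : ℂ | 1 / 2 < z.re} by
    simp; norm_num)] with z hz
  exact mellin_twistRay_of_half_lt_re h1 h2 hz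

theorem twistZeta_ne_zero {t : ℝ} (h : riemannZeta (1 / 2 + t * Complex.I) ≠ 0) :
    twistZeta (1 / 2 + t * Complex.I) ≠ 0 := by
  unfold twistZeta
  refine mul_ne_zero ?_ h
  set s : ℂ := 1 / 2 + t * Complex.I
  have h4 : (4 : ℂ) ^ (-s) = (2 : ℂ) ^ (-s) * (2 : ℂ) ^ (-s) := by
    have := Complex.natCast_mul_natCast_cpow 2 2 (-s)
    norm_num at this
    exact this
  have hn : ‖(2 : ℂ) ^ (-s)‖ = (2 : ℝ) ^ (-(1 / 2) : ℝ) := by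
    have := Complex.norm_cpow_eq_rpow_re_of_pos (x := 2) two_pos (-s)
    simpa [s] using this
  have hsq : ((2 : ℝ) ^ (-(1 / 2) : ℝ)) ^ 2 = 1 / 2 := by
    rw [← Real.rpow_natCast, ← Real.rpow_mul (by norm_num)]
    norm_num
  intro h0
  rw [h4] at h0
  have hf : (1 - (2 : ℂ) ^ (-s)) * (1 - 2 * (2 : ℂ) ^ (-s)) = 0 := by linear_combination h0
  rcases mul_eq_zero.mp hf with h5 | h5
  · have : (2 : ℂ) ^ (-s) = 1 := by linear_combination -h5
    rw [this, norm_one] at hn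
    rw [← hn] at hsq
    norm_num at hsq
  · have : (2 : ℂ) ^ (-s) = 1 / 2 := by linear_combination -h5 / 2
    rw [this] at hn
    rw [← hn] at hsq
    norm_num at hsq

open MeasureTheory Set in
/-- A local bound on windows of length `h` integrates to a global bound against a slowly varying
weight. -/
theorem lintegral_mul_le_of_window {ρ k B : ℝ → ENNReal} (hρ : Measurable ρ) (hk : Measurable k)
    {h : ℝ} {c : ENNReal}
    (hc : c ≠ ⊤) (hkc : ∀ v, ∀ v' ∈ Icc (v - h) v, k v ≤ c * k v')
    (hB : ∀ v', ∫⁻ v in Icc v' (v' + h), ρ v ≤ B v') :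
    ENNReal.ofReal h * ∫⁻ v, ρ v * k v ≤ c * ∫⁻ v, k v * B v := by
  have hS : MeasurableSet {x : ℝ × ℝ | x.2 ∈ Icc (x.1 - h) x.1} := by
    apply IsClosed.measurableSet
    simp only [mem_Icc, Set.ofPred_and]
    exact (isClosed_le (by fun_prop) (by fun_prop)).inter (isClosed_le (by fun_prop) (by fun_prop))
  let G : ℝ → ℝ → ENNReal := fun v v' =>
    ({x : ℝ × ℝ | x.2 ∈ Icc (x.1 - h) x.1}).indicator (fun x => ρ x.1 * (c * k x.2)) (v, v')
  have hG : Measurable (Function.uncurry G) := by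
    have : Function.uncurry G = ({x : ℝ × ℝ | x.2 ∈ Icc (x.1 - h) x.1}).indicator
        (fun x => ρ x.1 * (c * k x.2)) := by
      ext ⟨a, b⟩; rfl
    rw [this]
    exact Measurable.indicator (by fun_prop) hS
  calc ENNReal.ofReal h * ∫⁻ v, ρ v * k v
      = ∫⁻ v, ENNReal.ofReal h * (ρ v * k v) := by rw [lintegral_const_mul _ (by fun_prop)]
    _ ≤ ∫⁻ v, ∫⁻ v', G v v' := by
        refine lintegral_mono fun v => ?_
        have h1 : ∀ v', G v v' = (Icc (v - h) v).indicator (fun v' => ρ v * (c * k v')) v' := by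
          intro v'
          simp only [G, indicator, Set.mem_ofPred_eq]
        simp_rw [h1]
        rw [lintegral_indicator measurableSet_Icc]
        calc ENNReal.ofReal h * (ρ v * k v) = ∫⁻ v' in Icc (v - h) v, ρ v * k v := by
              rw [setLIntegral_const, Real.volume_Icc, mul_comm]
              congr 2
              ring
          _ ≤ _ := by
              refine setLIntegral_mono (by fun_prop) fun v' hv' => ?_
              gcongr
              exact hkc v v' hv'
    _ = ∫⁻ v', ∫⁻ v, G v v' := lintegral_lintegral_swap hG.aemeasurable
    _ ≤ ∫⁻ v', c * (k v' * B v') := by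
        refine lintegral_mono fun v' => ?_
        have h1 : ∀ v, G v v' = (Icc v' (v' + h)).indicator (fun v => ρ v * (c * k v')) v := by
          intro v
          simp only [G, indicator, Set.mem_ofPred_eq, mem_Icc]
          have : (v - h ≤ v' ∧ v' ≤ v) ↔ (v' ≤ v ∧ v ≤ v' + h) := by
            constructor <;> rintro ⟨a, b⟩ <;> constructor <;> linarith
          simp only [this]
        simp_rw [h1]
        rw [lintegral_indicator measurableSet_Icc, lintegral_mul_const _ hρ]
        calc _ ≤ B v' * (c * k v') := by gcongr; exact hB v'
          _ = _ := by ring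
    _ ≤ c * ∫⁻ v, k v * B v := by
        rw [lintegral_const_mul' _ _ hc]

open MeasureTheory Set Filter in
theorem exists_lintegral_twistRay_sq_le : ∃ C : ℝ, 0 < C ∧ ∀ δ : ℝ, 0 < δ → δ ≤ 1 →
    ∀ X Y : ℝ, 0 < X → X ≤ Y →
    ∫⁻ x in Icc X Y, ‖twistRay (Real.pi / 2 - δ) x‖ₑ ^ 2 ≤
      ENNReal.ofReal (C * Real.exp (-(Real.pi / 4 * Real.sin δ * X / 2)) *
        ((Y - X) * (Real.pi / 4 * Real.sin δ * X) ^ (-(1 / 2) : ℝ) +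
          (Real.pi / 4 * Real.sin δ * X) ^ (-(3 / 8) : ℝ))) := by
  obtain ⟨C, hC0, hC⟩ := exists_integral_norm_sum_sq_le
  refine ⟨C, hC0, fun δ hδ0 hδ1 X Y hX hXY => ?_⟩
  set p := Real.pi / 4 * Real.sin δ
  set q := Real.pi / 4 * Real.cos δ
  have hp : 0 < p := by
    have := Real.sin_pos_of_pos_of_le_one hδ0 hδ1
    positivity
  have hq : 1 / 4 ≤ q := by
    have h1 : 1 / 2 ≤ Real.cos δ :=
      le_trans (by nlinarith) (Real.one_sub_sq_div_two_le_cos (x := δ))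
    have := Real.pi_gt_three
    change 1 / 4 ≤ Real.pi / 4 * Real.cos δ
    nlinarith
  have hexp : Complex.exp ((Real.pi / 2 - δ : ℝ) * Complex.I) =
      Real.sin δ + Real.cos δ * Complex.I := by
    rw [Complex.exp_mul_I, ← Complex.ofReal_cos, ← Complex.ofReal_sin, Real.cos_pi_div_two_sub,
      Real.sin_pi_div_two_sub]
  let S : ℕ → ℝ → ℂ := fun N x => ∑ n ∈ Finset.range N, (twistCoeff n : ℂ) *
      Complex.exp (-((((n : ℝ) + 1) ^ 2 : ℝ) * x * (p + q * Complex.I)))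
  have hScont : ∀ N, Continuous (S N) := fun N => by fun_prop
  have hlim : ∀ x ∈ Icc X Y, Tendsto (fun N => ‖S N x‖ₑ ^ 2) atTop
      (nhds (‖twistRay (Real.pi / 2 - δ) x‖ₑ ^ 2)) := by
    intro x hx
    have hx0 : 0 < x := hX.trans_le hx.1
    have h1 := (hasSum_twistTheta (z := Complex.exp ((Real.pi / 2 - δ : ℝ) * Complex.I) * x)
      (by
        rw [Complex.re_mul_ofReal, Complex.exp_ofReal_mul_I_re, Real.cos_pi_div_two_sub]
        have := Real.sin_pos_of_pos_of_le_one hδ0 hδ1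
        positivity)).tendsto_sum_nat
    have h2 : ∀ N, S N x = ∑ n ∈ Finset.range N, (twistCoeff n : ℂ) *
        Complex.exp (-(Real.pi / 4 * ((n : ℂ) + 1) ^ 2 *
          (Complex.exp ((Real.pi / 2 - δ : ℝ) * Complex.I) * x))) := by
      intro N
      refine Finset.sum_congr rfl fun n _ => ?_
      rw [hexp]
      congr 3
      simp only [p, q]
      push_cast
      ring
    simp_rw [h2]
    exact ((ENNReal.continuous_pow 2).tendsto _).comp ((continuous_enorm.tendsto _).comp h1)
  calc ∫⁻ x in Icc X Y, ‖twistRay (Real.pi / 2 - δ) x‖ₑ ^ 2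
      = ∫⁻ x in Icc X Y, liminf (fun N => ‖S N x‖ₑ ^ 2) atTop :=
        setLIntegral_congr_fun measurableSet_Icc fun x hx => (hlim x hx).liminf_eq.symm
    _ ≤ liminf (fun N => ∫⁻ x in Icc X Y, ‖S N x‖ₑ ^ 2) atTop :=
        lintegral_liminf_le fun N => by have := hScont N; fun_prop
    _ ≤ _ := by
        refine liminf_le_of_le (by isBoundedDefault) fun b hb => ?_
        obtain ⟨N, hN⟩ := hb.exists
        refine hN.trans ?_
        have h3 : ∫⁻ x in Icc X Y, ‖S N x‖ₑ ^ 2 =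
            ENNReal.ofReal (∫ x in X..Y, ‖S N x‖ ^ 2) := by
          rw [intervalIntegral.integral_of_le hXY, ← integral_Icc_eq_integral_Ioc,
            ofReal_integral_eq_lintegral_ofReal]
          · refine lintegral_congr fun x => ?_
            rw [ENNReal.ofReal_pow (norm_nonneg _), ofReal_norm]
          · exact (by have := hScont N; fun_prop : Continuous fun x => ‖S N x‖ ^ 2).continuousOn.integrableOn_Icc
          · exact Eventually.of_forall fun x => by positivity
        rw [h3]
        exact ENNReal.ofReal_le_ofReal (hC twistCoeff abs_twistCoeff_le p q X Y hp hq hX hXY N)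

open MeasureTheory Set in
theorem exists_lintegral_twistKernel_sq_le : ∃ C : ℝ, 0 < C ∧ ∀ δ : ℝ, 0 < δ → δ ≤ 1 →
    ∀ h : ℝ, 0 < h → h ≤ 1 → ∀ v : ℝ, 0 ≤ v →
    ∫⁻ u in Icc v (v + h), ‖twistKernel (Real.pi / 2 - δ) u‖ₑ ^ 2 ≤
      ENNReal.ofReal (C * Real.exp (-(Real.pi / 4 * Real.sin δ * Real.exp v / 2)) *
        (2 * h * (Real.pi / 4 * Real.sin δ) ^ (-(1 / 2) : ℝ) +
          (Real.pi / 4 * Real.sin δ) ^ (-(3 / 8) : ℝ))) := by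
  obtain ⟨C, hC0, hC⟩ := exists_lintegral_twistRay_sq_le
  refine ⟨C, hC0, fun δ hδ0 hδ1 h hh0 hh1 v hv => ?_⟩
  have hα1 : -(Real.pi / 2) < Real.pi / 2 - δ := by linarith [Real.pi_gt_three]
  have hα2 : Real.pi / 2 - δ < Real.pi / 2 := by linarith
  set α := Real.pi / 2 - δ
  have hs := Real.sin_pos_of_pos_of_le_one hδ0 hδ1
  set p := Real.pi / 4 * Real.sin δ
  have hp : 0 < p := by positivity
  set X := Real.exp v
  have hX1 : 1 ≤ X := Real.one_le_exp hv
  have hX0 : 0 < X := by linarith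
  set Y := Real.exp (v + h)
  have hXY : X ≤ Y := Real.exp_le_exp.mpr (by linarith)
  have hY : Y - X ≤ 2 * h * X := by
    have h1 := Real.abs_exp_sub_one_le (x := h) (by rwa [abs_of_pos hh0])
    have h2 := (le_abs_self _).trans h1
    rw [abs_of_pos hh0] at h2
    have h3 : Y - X = X * (Real.exp h - 1) := by simp only [Y, X, Real.exp_add]; ring
    rw [h3]
    nlinarith
  have himg : Real.exp '' Icc v (v + h) ⊆ Icc X Y := by
    rintro _ ⟨u, hu, rfl⟩
    exact ⟨Real.exp_le_exp.mpr hu.1, Real.exp_le_exp.mpr hu.2⟩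
  calc ∫⁻ u in Icc v (v + h), ‖twistKernel α u‖ₑ ^ 2
      ≤ ∫⁻ u in Icc v (v + h), ENNReal.ofReal (X ^ (-(1 / 2) : ℝ)) *
          (ENNReal.ofReal |Real.exp u| * ‖twistRay α (Real.exp u)‖ₑ ^ 2) := by
        refine setLIntegral_mono' measurableSet_Icc fun u hu => ?_
        have h1 : ‖twistKernel α u‖ ^ 2 ≤
            X ^ (-(1 / 2) : ℝ) * (|Real.exp u| * ‖twistRay α (Real.exp u)‖ ^ 2) := by
          rw [norm_twistRay (Real.exp_pos u), Real.log_exp, norm_twistKernel_neg hα1 hα2, abs_of_pos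
            (Real.exp_pos u), mul_pow, ← mul_assoc, ← mul_assoc]
          refine le_mul_of_one_le_left (by positivity) ?_
          rw [← Real.exp_mul, ← Real.exp_mul, ← Real.exp_nat_mul, ← Real.exp_add, ← Real.exp_add,
            Real.one_le_exp_iff]
          push_cast
          linarith [hu.1]
        have h2 := ENNReal.ofReal_le_ofReal h1
        rwa [ENNReal.ofReal_mul (by positivity), ENNReal.ofReal_mul (by positivity),
          ENNReal.ofReal_pow (norm_nonneg _), ENNReal.ofReal_pow (norm_nonneg _), ofReal_norm,
          ofReal_norm] at h2
    _ = ENNReal.ofReal (X ^ (-(1 / 2) : ℝ)) *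
          ∫⁻ x in Real.exp '' Icc v (v + h), ‖twistRay α x‖ₑ ^ 2 := by
        rw [lintegral_const_mul' _ _ ENNReal.ofReal_ne_top,
          lintegral_image_eq_lintegral_abs_deriv_mul measurableSet_Icc
          (fun x _ => (Real.hasDerivAt_exp x).hasDerivWithinAt) Real.exp_injective.injOn]
    _ ≤ ENNReal.ofReal (X ^ (-(1 / 2) : ℝ)) * ∫⁻ x in Icc X Y, ‖twistRay α x‖ₑ ^ 2 := by
        gcongr
    _ ≤ _ := by
        refine (mul_le_mul_right (hC δ hδ0 hδ1 X Y hX0 hXY) _).trans ?_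
        rw [← ENNReal.ofReal_mul (by positivity)]
        apply ENNReal.ofReal_le_ofReal
        have h1 : X ^ (-(1 / 2) : ℝ) * ((Y - X) * (p * X) ^ (-(1 / 2) : ℝ)) ≤
            2 * h * p ^ (-(1 / 2) : ℝ) := by
          rw [Real.mul_rpow hp.le hX0.le]
          have h2 : X ^ (-(1 / 2) : ℝ) * X ^ (-(1 / 2) : ℝ) * X = 1 := by
            rw [← Real.rpow_add hX0, ← Real.rpow_add_one hX0.ne']
            norm_num
          calc _ ≤ X ^ (-(1 / 2) : ℝ) * ((2 * h * X) * (p ^ (-(1 / 2) : ℝ) * X ^ (-(1 / 2) : ℝ))) := by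
                gcongr
            _ = 2 * h * p ^ (-(1 / 2) : ℝ) * (X ^ (-(1 / 2) : ℝ) * X ^ (-(1 / 2) : ℝ) * X) := by ring
            _ = _ := by rw [h2, mul_one]
        have h2 : X ^ (-(1 / 2) : ℝ) * (p * X) ^ (-(3 / 8) : ℝ) ≤ p ^ (-(3 / 8) : ℝ) := by
          rw [Real.mul_rpow hp.le hX0.le]
          have h3 := Real.rpow_le_one_of_one_le_of_nonpos hX1 (by norm_num : (-(1 / 2) : ℝ) ≤ 0)
          have h4 := Real.rpow_le_one_of_one_le_of_nonpos hX1 (by norm_num : (-(3 / 8) : ℝ) ≤ 0)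
          calc _ ≤ 1 * (p ^ (-(3 / 8) : ℝ) * 1) := by gcongr
            _ = _ := by ring
        calc _ = C * Real.exp (-(p * X / 2)) * (X ^ (-(1 / 2) : ℝ) * ((Y - X) * (p * X) ^ (-(1 / 2) : ℝ)) +
              X ^ (-(1 / 2) : ℝ) * (p * X) ^ (-(3 / 8) : ℝ)) := by ring
          _ ≤ _ := by gcongr

open MeasureTheory Set in
/-- Weighted mean square of the kernel, for weights that are slowly varying and essentially
carried by the positive half line. -/
theorem exists_lintegral_twistKernel_mul_le : ∃ C : ℝ, 0 < C ∧ ∀ δ : ℝ, 0 < δ → δ ≤ 1 →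
    ∀ h : ℝ, 0 < h → h ≤ 1 → ∀ k : ℝ → ENNReal, Measurable k → (∀ v, 0 ≤ v → k (-v) ≤ k v) →
    ∀ c : ENNReal, c ≠ ⊤ → (∀ v, ∀ v' ∈ Icc (v - h) v, k v ≤ c * k v') →
    ENNReal.ofReal h * ∫⁻ u, ‖twistKernel (Real.pi / 2 - δ) u‖ₑ ^ 2 * k u ≤
      2 * c * ENNReal.ofReal (C * (2 * h * (Real.pi / 4 * Real.sin δ) ^ (-(1 / 2) : ℝ) +
          (Real.pi / 4 * Real.sin δ) ^ (-(3 / 8) : ℝ))) *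
        ∫⁻ v, k v * ENNReal.ofReal (Real.exp (-(Real.pi / 4 * Real.sin δ * Real.exp v / 2))) := by
  obtain ⟨C, hC0, hC⟩ := exists_lintegral_twistKernel_sq_le
  refine ⟨C, hC0, fun δ hδ0 hδ1 h hh0 hh1 k hk hkneg c hc hkc => ?_⟩
  have hC' := hC δ hδ0 hδ1 h hh0 hh1
  have hα1 : -(Real.pi / 2) < Real.pi / 2 - δ := by linarith [Real.pi_gt_three]
  have hα2 : Real.pi / 2 - δ < Real.pi / 2 := by linarith
  set α := Real.pi / 2 - δ
  have hs := Real.sin_pos_of_pos_of_le_one hδ0 hδ1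
  set p := Real.pi / 4 * Real.sin δ
  have hp : 0 < p := by positivity
  set A := 2 * h * p ^ (-(1 / 2) : ℝ) + p ^ (-(3 / 8) : ℝ)
  have hA : 0 < A := by positivity
  let ρ : ℝ → ENNReal := (Ici 0).indicator fun u => ‖twistKernel α u‖ₑ ^ 2
  have hcont := continuous_twistKernel hα1 hα2
  have hm : Measurable fun u => ‖twistKernel α u‖ₑ ^ 2 := by fun_prop
  have hρ : Measurable ρ := hm.indicator measurableSet_Ici
  have hB : ∀ v, ∫⁻ u in Icc v (v + h), ρ u ≤
      ENNReal.ofReal (C * A) * ENNReal.ofReal (Real.exp (-(p * Real.exp v / 2))) := by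
    intro v
    rw [setLIntegral_indicator measurableSet_Ici, ← ENNReal.ofReal_mul (by positivity)]
    calc ∫⁻ u in Ici 0 ∩ Icc v (v + h), ‖twistKernel α u‖ₑ ^ 2
        ≤ ∫⁻ u in Icc (max v 0) (max v 0 + h), ‖twistKernel α u‖ₑ ^ 2 := by
          refine lintegral_mono_set fun u hu => ⟨max_le hu.2.1 hu.1, hu.2.2.trans ?_⟩
          gcongr
          exact le_max_left _ _
      _ ≤ _ := hC' _ (le_max_right _ _)
      _ ≤ _ := by
          apply ENNReal.ofReal_le_ofReal
          calc _ = C * A * Real.exp (-(p * Real.exp (max v 0) / 2)) := by ring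
            _ ≤ _ := by
              gcongr
              exact le_max_left _ _
  have h1 := lintegral_mul_le_of_window hρ hk hc hkc hB
  have h2 : ∫⁻ u, ‖twistKernel α u‖ₑ ^ 2 * k u ≤ 2 * ∫⁻ u, ρ u * k u := by
    have h3 : ∫⁻ u in Ici 0, ‖twistKernel α u‖ₑ ^ 2 * k u = ∫⁻ u, ρ u * k u := by
      rw [← lintegral_indicator measurableSet_Ici]
      refine lintegral_congr fun u => ?_
      simp only [ρ, indicator]
      split_ifs <;> simp
    have h4 : ∫⁻ u in Iio 0, ‖twistKernel α u‖ₑ ^ 2 * k u ≤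
        ∫⁻ u in Ici 0, ‖twistKernel α u‖ₑ ^ 2 * k u := by
      rw [← lintegral_indicator measurableSet_Ici, ← lintegral_indicator measurableSet_Iio,
        ← lintegral_neg_eq_self]
      refine lintegral_mono fun u => ?_
      simp only [indicator, mem_Iio, mem_Ici]
      have hn : ‖twistKernel α (-u)‖ₑ = ‖twistKernel α u‖ₑ := by
        rw [← ofReal_norm, ← ofReal_norm, norm_twistKernel_neg hα1 hα2]
      by_cases hu : 0 < u
      · rw [if_pos (by linarith), if_pos hu.le, hn]
        gcongr
        exact hkneg u hu.le
      · rw [if_neg (by linarith)]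
        exact zero_le
    rw [h3] at h4
    rw [← lintegral_add_compl (fun u => ‖twistKernel α u‖ₑ ^ 2 * k u)
      (measurableSet_Ici (a := (0 : ℝ))), compl_Ici, h3, two_mul]
    gcongr
  calc _ ≤ ENNReal.ofReal h * (2 * ∫⁻ u, ρ u * k u) := by gcongr
    _ = 2 * (ENNReal.ofReal h * ∫⁻ u, ρ u * k u) := by ring
    _ ≤ 2 * (c * ∫⁻ v, k v * (ENNReal.ofReal (C * A) *
          ENNReal.ofReal (Real.exp (-(p * Real.exp v / 2))))) := by gcongr
    _ = 2 * c * ∫⁻ v, ENNReal.ofReal (C * A) * (k v *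
          ENNReal.ofReal (Real.exp (-(p * Real.exp v / 2)))) := by
        rw [mul_assoc]
        congr 3
        ext v
        ring
    _ = _ := by
        rw [lintegral_const_mul' _ _ ENNReal.ofReal_ne_top]
        ring

open MeasureTheory in
theorem lintegral_comp_div_ofReal {a : ℝ} (ha : 0 < a) (f : ℝ → ENNReal) :
    ∫⁻ x, f (x / a) = ENNReal.ofReal a * ∫⁻ x, f x := by
  have h1 := lintegral_map_equiv (μ := volume) f (MeasurableEquiv.mulLeft₀ a⁻¹ (inv_ne_zero ha.ne'))
  have h2 : Measure.map (MeasurableEquiv.mulLeft₀ a⁻¹ (inv_ne_zero ha.ne')) volume =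
      ENNReal.ofReal a • volume := by
    have := Real.map_volume_mul_left (inv_ne_zero ha.ne')
    rw [inv_inv, abs_of_pos ha] at this
    exact this
  rw [h2, lintegral_smul_measure, smul_eq_mul] at h1
  rw [h1]
  refine lintegral_congr fun x => ?_
  simp [div_eq_inv_mul]

open MeasureTheory in
theorem lintegral_enorm_fourier_div_sq_le {g : ℝ → ℂ} (hg : Integrable g) :
    ∫⁻ τ : ℝ, ‖FourierTransform.fourier g (τ / (2 * Real.pi))‖ₑ ^ 2 ≤
      ENNReal.ofReal (2 * Real.pi) * ∫⁻ u, ‖g u‖ₑ ^ 2 := by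
  rw [lintegral_comp_div_ofReal Real.two_pi_pos fun x => ‖FourierTransform.fourier g x‖ₑ ^ 2]
  exact mul_le_mul_right (lintegral_enorm_fourier_sq_le hg) _

theorem exists_norm_mellin_twistRay_ge : ∃ c : ℝ, 0 < c ∧ ∀ T : ℝ, 1 ≤ T →
    ∀ κ ∈ Set.Icc (1 / 4 : ℝ) (3 / 2), ∀ τ ∈ Set.Icc T (3 * T),
    c * T ^ (κ - 1 / 2) * ‖twistZeta (2 * (κ + τ * Complex.I))‖ ≤
      ‖mellin (twistRay (Real.pi / 2 - 1 / T)) (κ + τ * Complex.I)‖ := by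
  obtain ⟨c, hc0, hc⟩ := exists_norm_Gamma_ge
  refine ⟨c * Real.exp (-3) / 3, by positivity, fun T hT κ hκ τ hτ => ?_⟩
  have hT0 : 0 < T := by linarith
  have hτ0 : 0 < τ := hT0.trans_le hτ.1
  have hδ1 : 1 / T ≤ 1 := (div_le_one hT0).mpr hT
  have hδ0 : 0 < 1 / T := by positivity
  have hπ := Real.pi_gt_three
  rw [mellin_twistRay_eq (by linarith) (by linarith) (by simp; linarith [hκ.1]) (by simpa)]
  rw [norm_mul, norm_mul, norm_mul, Complex.norm_exp,
    Complex.norm_cpow_eq_rpow_re_of_pos (by positivity)]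
  have h1 : (-(((Real.pi / 2 - 1 / T : ℝ) : ℂ) * Complex.I * (κ + τ * Complex.I))).re =
      Real.pi * τ / 2 - τ / T := by
    simp
    ring
  have h2 : (-((κ : ℂ) + τ * Complex.I)).re = -κ := by simp
  have h3 : 1 ≤ (Real.pi / 4) ^ (-κ) := by
    apply Real.one_le_rpow_of_pos_of_le_one_of_nonpos (by positivity)
    · linarith [Real.pi_le_four]
    · linarith [hκ.1]
  have h4 : τ ^ (κ - 1 / 2) = T ^ (κ - 1 / 2) * (τ / T) ^ (κ - 1 / 2) := by
    rw [← Real.mul_rpow hT0.le (by positivity)]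
    congr 1
    field_simp
  have h5 : 1 ≤ τ / T := (one_le_div hT0).mpr hτ.1
  have h5' : τ / T ≤ 3 := (div_le_iff₀ hT0).mpr hτ.2
  have h6 : 1 / 3 ≤ (τ / T) ^ (κ - 1 / 2) := by
    calc (1 / 3 : ℝ) ≤ (τ / T) ^ (-1 : ℝ) := by
          rw [Real.rpow_neg_one, ← one_div]
          gcongr
      _ ≤ _ := Real.rpow_le_rpow_of_exponent_le h5 (by linarith [hκ.1])
  have h7 : Real.exp (-3) ≤ Real.exp (-(τ / T)) := Real.exp_le_exp.mpr (by linarith)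
  have h8 := hc κ hκ τ (hT.trans hτ.1)
  rw [h1, h2]
  refine mul_le_mul_of_nonneg_right ?_ (norm_nonneg _)
  calc c * Real.exp (-3) / 3 * T ^ (κ - 1 / 2)
      = Real.exp (-3) * 1 * (c * (T ^ (κ - 1 / 2) * (1 / 3))) := by ring
    _ ≤ Real.exp (-(τ / T)) * (Real.pi / 4) ^ (-κ) *
          (c * (T ^ (κ - 1 / 2) * (τ / T) ^ (κ - 1 / 2))) := by gcongr
    _ = Real.exp (Real.pi * τ / 2 - τ / T) * (Real.pi / 4) ^ (-κ) *
          (c * (τ ^ (κ - 1 / 2) * Real.exp (-(Real.pi * τ / 2)))) := by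
        rw [← h4, sub_eq_add_neg (Real.pi * τ / 2), Real.exp_add]
        have : Real.exp (Real.pi * τ / 2) * Real.exp (-(Real.pi * τ / 2)) = 1 := by
          rw [← Real.exp_add]; simp
        linear_combination (-(Real.exp (-(τ / T)) * (Real.pi / 4) ^ (-κ) * (c * τ ^ (κ - 1 / 2)))) *
          this
    _ ≤ _ := by gcongr

open MeasureTheory Set in
theorem lintegral_exp_mul_exp_neg_exp {μ r : ℝ} (hμ : 0 < μ) (hr : 0 < r) :
    ∫⁻ v, ENNReal.ofReal (Real.exp (μ * v)) * ENNReal.ofReal (Real.exp (-(r * Real.exp v))) =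
      ENNReal.ofReal ((1 / r) ^ μ * Real.Gamma μ) := by
  have h1 : IntegrableOn (fun t : ℝ => t ^ (μ - 1) * Real.exp (-(r * t))) (Ioi 0) := by
    have := integrableOn_rpow_mul_exp_neg_mul_rpow (p := 1) (s := μ - 1) (b := r) (by linarith)
      one_pos hr
    simpa using this
  rw [← Real.integral_rpow_mul_exp_neg_mul_Ioi hμ hr, ofReal_integral_eq_lintegral_ofReal h1]
  · rw [← Real.range_exp, ← image_univ, lintegral_image_eq_lintegral_abs_deriv_mul MeasurableSet.univ
      (fun x _ => (Real.hasDerivAt_exp x).hasDerivWithinAt) Real.exp_injective.injOn,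
      setLIntegral_univ]
    refine lintegral_congr fun v => ?_
    rw [← ENNReal.ofReal_mul (by positivity), ← ENNReal.ofReal_mul (by positivity), abs_of_pos
      (Real.exp_pos v)]
    simp only [← Real.exp_mul, ← Real.exp_add]
    congr 2
    ring
  · filter_upwards [ae_restrict_mem measurableSet_Ioi] with t ht
    have : 0 < t := ht
    positivity

theorem Real.Gamma_le_div {μ : ℝ} (h0 : 0 < μ) (h1 : μ ≤ 3) : Real.Gamma μ ≤ 6 / μ := by
  rw [le_div_iff₀ h0, mul_comm, ← Real.Gamma_add_one h0.ne']
  have h := Real.convexOn_Gamma.le_max_of_mem_Icc (x := 1) (y := 4) (z := μ + 1)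
    (by simp) (by simp) ⟨by linarith, by linarith⟩
  refine h.trans ?_
  have h3 : Real.Gamma 4 = 6 := by
    rw [show (4 : ℝ) = ((3 : ℕ) : ℝ) + 1 by norm_num, Real.Gamma_nat_eq_factorial]
    norm_num [Nat.factorial]
  rw [Real.Gamma_one, h3]
  norm_num

theorem one_div_two_mul_le_pi_div_four_mul_sin {T : ℝ} (hT : 1 ≤ T) :
    1 / (2 * T) ≤ Real.pi / 4 * Real.sin (1 / T) := by
  have hT0 : 0 < T := by linarith
  have hδ1 : 1 / T ≤ 1 := (div_le_one hT0).mpr hT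
  have h := Real.mul_le_sin (x := 1 / T) (by positivity) (by linarith [Real.pi_gt_three])
  calc 1 / (2 * T) = Real.pi / 4 * (2 / Real.pi * (1 / T)) := by
        field_simp
        norm_num
    _ ≤ _ := by gcongr

theorem pi_div_four_mul_sin_le_one (x : ℝ) : Real.pi / 4 * Real.sin x ≤ 1 := by
  nlinarith [Real.pi_le_four, Real.sin_le_one x, Real.pi_pos]

open MeasureTheory Set in
theorem lintegral_enorm_mellin_twistRay_sq_le {α : ℝ} (h1 : -(Real.pi / 2) < α)
    (h2 : α < Real.pi / 2) (κ : ℝ) :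
    ∫⁻ τ : ℝ, ‖mellin (twistRay α) (κ + τ * Complex.I)‖ₑ ^ 2 ≤ ENNReal.ofReal (2 * Real.pi) *
      ∫⁻ u, ‖twistKernel α u‖ₑ ^ 2 * ENNReal.ofReal (Real.exp ((2 * κ - 1 / 2) * u)) := by
  have h3 : ∀ τ : ℝ, ‖mellin (twistRay α) (κ + τ * Complex.I)‖ₑ =
      ‖FourierTransform.fourier (fun u : ℝ => (Real.exp (-(κ - 1 / 4) * u) : ℂ) * twistKernel α u)
        (τ / (2 * Real.pi))‖ₑ := by
    intro τ
    have := mellin_twistRay α (κ + τ * Complex.I)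
    simp only [Complex.add_re, Complex.ofReal_re, Complex.mul_re, Complex.I_re, mul_zero,
      Complex.ofReal_im, Complex.I_im, mul_one, sub_self, add_zero, Complex.add_im,
      Complex.mul_im, zero_add] at this
    rw [← this, ← ofReal_norm, ← ofReal_norm, norm_mul, Complex.norm_exp]
    simp
  simp_rw [h3]
  refine (lintegral_enorm_fourier_div_sq_le (integrable_exp_mul_twistKernel h1 h2 _)).trans_eq ?_
  congr 1
  rw [← lintegral_neg_eq_self]
  refine lintegral_congr fun u => ?_
  rw [← ofReal_norm, ← ofReal_norm, norm_mul, norm_twistKernel_neg h1 h2, Complex.norm_real,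
    Real.norm_of_nonneg (Real.exp_pos _).le, ← ENNReal.ofReal_pow (by positivity),
    ← ENNReal.ofReal_pow (by positivity), ← ENNReal.ofReal_mul (by positivity), mul_pow,
    ← Real.exp_nat_mul, mul_comm]
  congr 3
  push_cast
  ring

open MeasureTheory Set in
theorem exists_lintegral_twistZeta_sq_le : ∃ C : ℝ, 0 < C ∧ ∀ T : ℝ, 1 ≤ T → ∀ κ : ℝ,
    1 / 4 < κ → κ ≤ 3 / 2 →
    ∫⁻ τ in Icc T (3 * T), ‖twistZeta (2 * (κ + τ * Complex.I))‖ₑ ^ 2 ≤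
      ENNReal.ofReal (C * T / (2 * κ - 1 / 2)) := by
  obtain ⟨C, hC0, hC⟩ := exists_lintegral_twistKernel_mul_le
  obtain ⟨c, hc0, hc⟩ := exists_norm_mellin_twistRay_ge
  set C₁ := 2 * Real.pi * (2 * Real.exp (5 / 2) * (C * 3) * (8 * 6)) with hC₁
  refine ⟨8 * C₁ / c ^ 2, by positivity, fun T hT κ hκ0 hκ1 => ?_⟩
  have hT0 : 0 < T := by linarith
  have hδ1 : 1 / T ≤ 1 := (div_le_one hT0).mpr hT
  have hδ0 : 0 < 1 / T := by positivity
  have hp1 := one_div_two_mul_le_pi_div_four_mul_sin hT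
  have hp2 := pi_div_four_mul_sin_le_one (1 / T)
  have hκ : κ ∈ Icc (1 / 4 : ℝ) (3 / 2) := ⟨hκ0.le, hκ1⟩
  have hα1 : -(Real.pi / 2) < Real.pi / 2 - 1 / T := by linarith [Real.pi_gt_three]
  have hα2 : Real.pi / 2 - 1 / T < Real.pi / 2 := by linarith
  set μ := 2 * κ - 1 / 2 with hμ
  have hμ0 : 0 < μ := by linarith
  have hμ1 : μ ≤ 5 / 2 := by linarith
  have hC' := hC (1 / T) hδ0 hδ1 1 one_pos le_rfl
    (fun v => ENNReal.ofReal (Real.exp (μ * v))) (by fun_prop)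
    (fun v hv => ENNReal.ofReal_le_ofReal (Real.exp_le_exp.mpr (by nlinarith)))
    (ENNReal.ofReal (Real.exp (5 / 2))) ENNReal.ofReal_ne_top (fun v v' hv' => by
      rw [← ENNReal.ofReal_mul (by positivity), ← Real.exp_add]
      refine ENNReal.ofReal_le_ofReal (Real.exp_le_exp.mpr ?_)
      nlinarith [hv'.1])
  set p := Real.pi / 4 * Real.sin (1 / T)
  have hp0 : 0 < p := lt_of_lt_of_le (by positivity) hp1
  have hexp : ∀ v, Real.exp (-(p * Real.exp v / 2)) = Real.exp (-(p / 2 * Real.exp v)) := by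
    intro v; congr 1; ring
  simp_rw [hexp] at hC'
  rw [lintegral_exp_mul_exp_neg_exp hμ0 (by positivity), ENNReal.ofReal_one, one_mul] at hC'
  set D := c * T ^ (κ - 1 / 2) with hD
  have hD0 : 0 < D := by positivity
  have hD2 : D ^ 2 = c ^ 2 * T ^ (2 * κ - 1) := by
    rw [hD, mul_pow, ← Real.rpow_natCast (T ^ _), ← Real.rpow_mul hT0.le]
    congr 2
    push_cast
    ring
  have hmain : ENNReal.ofReal (D ^ 2) *
      ∫⁻ τ in Icc T (3 * T), ‖twistZeta (2 * (κ + τ * Complex.I))‖ₑ ^ 2 ≤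
      ENNReal.ofReal (C₁ * 8 * T ^ (2 * κ) / μ) := by
    calc _ = ∫⁻ τ in Icc T (3 * T),
          ENNReal.ofReal (D ^ 2) * ‖twistZeta (2 * (κ + τ * Complex.I))‖ₑ ^ 2 := by
          rw [lintegral_const_mul' _ _ ENNReal.ofReal_ne_top]
      _ ≤ ∫⁻ τ in Icc T (3 * T),
          ‖mellin (twistRay (Real.pi / 2 - 1 / T)) (κ + τ * Complex.I)‖ₑ ^ 2 := by
          refine setLIntegral_mono' measurableSet_Icc fun τ hτ => ?_
          have h := hc T hT κ hκ τ hτ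
          rw [← ofReal_norm, ← ofReal_norm, ← ENNReal.ofReal_pow (by positivity),
            ← ENNReal.ofReal_pow (by positivity), ← ENNReal.ofReal_mul (by positivity), ← mul_pow]
          gcongr
      _ ≤ ∫⁻ τ : ℝ, ‖mellin (twistRay (Real.pi / 2 - 1 / T)) (κ + τ * Complex.I)‖ₑ ^ 2 :=
          setLIntegral_le_lintegral _ _
      _ ≤ _ := lintegral_enorm_mellin_twistRay_sq_le hα1 hα2 κ
      _ ≤ _ := mul_le_mul_right hC' _
      _ ≤ _ := by
          have e2 : (2 : ENNReal) = ENNReal.ofReal 2 := by simp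
          rw [e2, ← ENNReal.ofReal_mul (by positivity), ← ENNReal.ofReal_mul (by positivity),
            ← ENNReal.ofReal_mul (by positivity), ← ENNReal.ofReal_mul (by positivity)]
          apply ENNReal.ofReal_le_ofReal
          have h1 : 2 * 1 * p ^ (-(1 / 2) : ℝ) + p ^ (-(3 / 8) : ℝ) ≤ 3 * p ^ (-(1 / 2) : ℝ) := by
            have := Real.rpow_le_rpow_of_exponent_ge hp0 hp2
              (by norm_num : (-(1 / 2) : ℝ) ≤ -(3 / 8))
            linarith
          have h2 : (1 / (p / 2)) ^ μ ≤ 8 * p ^ (-μ) := by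
            have : 1 / (p / 2) = 2 * p⁻¹ := by field_simp
            rw [this, Real.mul_rpow (by norm_num) (by positivity), Real.inv_rpow hp0.le,
              Real.rpow_neg hp0.le]
            gcongr
            calc (2 : ℝ) ^ μ ≤ 2 ^ (3 : ℝ) :=
                  Real.rpow_le_rpow_of_exponent_le (by norm_num) (by linarith)
              _ = 8 := by norm_num
          have h3 := Real.Gamma_le_div hμ0 (by linarith)
          have h4 : p ^ (-(1 / 2) : ℝ) * p ^ (-μ) ≤ 8 * T ^ (2 * κ) := by
            rw [← Real.rpow_add hp0]
            have h5 : -(1 / 2) + -μ = -(2 * κ) := by rw [hμ]; ring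
            rw [h5]
            calc p ^ (-(2 * κ)) ≤ (1 / (2 * T)) ^ (-(2 * κ)) :=
                  Real.rpow_le_rpow_of_nonpos (by positivity) hp1 (by linarith)
              _ = 2 ^ (2 * κ) * T ^ (2 * κ) := by
                  rw [one_div, Real.inv_rpow (by positivity), Real.rpow_neg (by positivity),
                    inv_inv, Real.mul_rpow (by norm_num) hT0.le]
              _ ≤ _ := by
                  gcongr
                  calc (2 : ℝ) ^ (2 * κ) ≤ 2 ^ (3 : ℝ) :=
                        Real.rpow_le_rpow_of_exponent_le (by norm_num) (by linarith)
                    _ = 8 := by norm_num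
          have hG := Real.Gamma_pos_of_pos hμ0
          calc _ ≤ 2 * Real.pi * (2 * Real.exp (5 / 2) * (C * (3 * p ^ (-(1 / 2) : ℝ))) *
                (8 * p ^ (-μ) * (6 / μ))) := by gcongr
            _ = C₁ * (p ^ (-(1 / 2) : ℝ) * p ^ (-μ)) / μ := by rw [hC₁]; ring
            _ ≤ C₁ * (8 * T ^ (2 * κ)) / μ := by gcongr
            _ = _ := by ring
  have h9 : C₁ * 8 * T ^ (2 * κ) / μ = D ^ 2 * (8 * C₁ / c ^ 2 * T / μ) := by
    rw [hD2]
    have : T ^ (2 * κ) = T ^ (2 * κ - 1) * T := by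
      rw [← Real.rpow_add_one hT0.ne']; congr 1; ring
    rw [this]
    field_simp
  rw [h9, ENNReal.ofReal_mul (by positivity)] at hmain
  exact (ENNReal.mul_le_mul_iff_right (by simpa using hD0.ne') ENNReal.ofReal_ne_top).mp hmain

open MeasureTheory Set in
theorem lintegral_two_mul_sub_rpow_neg_half_ne_top :
    ∫⁻ κ in Ioc (1 / 4 : ℝ) (3 / 2), ENNReal.ofReal ((2 * κ - 1 / 2) ^ (-(1 / 2) : ℝ)) ≠ ⊤ := by
  have h1 : IntervalIntegrable (fun x : ℝ => x ^ (-(1 / 2) : ℝ)) volume 0 (5 / 2) :=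
    intervalIntegral.intervalIntegrable_rpow' (by norm_num)
  have h2 := (h1.comp_sub_right (1 / 2)).comp_mul_left (c := 2)
  norm_num at h2
  rw [intervalIntegrable_iff_integrableOn_Ioc_of_le (by norm_num)] at h2
  have h3 := h2.lintegral_lt_top
  norm_num
  exact h3.ne

theorem continuousOn_twistZeta_two_mul :
    ContinuousOn (fun x : ℝ × ℝ => twistZeta (2 * (x.1 + x.2 * Complex.I)))
      (Set.univ ×ˢ Set.Ioi 0) := by
  intro x hx
  have hx : 0 < x.2 := hx.2
  have h1 : (2 * (x.1 + x.2 * Complex.I) : ℂ) ≠ 1 := by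
    intro h
    have := congrArg Complex.im h
    simp at this
    linarith
  refine ContinuousAt.continuousWithinAt ?_
  exact ContinuousAt.comp (f := fun x : ℝ × ℝ => 2 * ((x.1 : ℂ) + x.2 * Complex.I))
    (differentiableAt_twistZeta h1).continuousAt (by fun_prop)

open MeasureTheory Set in
theorem exists_lintegral_lintegral_twistZeta_le : ∃ C : ℝ, 0 < C ∧ ∀ T : ℝ, 1 ≤ T →
    ∫⁻ τ in Icc T (3 * T), ∫⁻ κ in Ioc (1 / 4 : ℝ) (3 / 2),
      ‖twistZeta (2 * (κ + τ * Complex.I))‖ₑ ≤ ENNReal.ofReal (C * T) := by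
  obtain ⟨C, hC0, hC⟩ := exists_lintegral_twistZeta_sq_le
  set I := ∫⁻ κ in Ioc (1 / 4 : ℝ) (3 / 2), ENNReal.ofReal ((2 * κ - 1 / 2) ^ (-(1 / 2) : ℝ))
  have hI : I ≠ ⊤ := lintegral_two_mul_sub_rpow_neg_half_ne_top
  refine ⟨(C + 2) * (I.toReal + 1), by positivity, fun T hT => ?_⟩
  have hT0 : 0 < T := by linarith
  rw [lintegral_lintegral_swap]
  · calc ∫⁻ κ in Ioc (1 / 4 : ℝ) (3 / 2), ∫⁻ τ in Icc T (3 * T),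
          ‖twistZeta (2 * (κ + τ * Complex.I))‖ₑ
        ≤ ∫⁻ κ in Ioc (1 / 4 : ℝ) (3 / 2), ENNReal.ofReal ((C + 2) * T) *
            ENNReal.ofReal ((2 * κ - 1 / 2) ^ (-(1 / 2) : ℝ)) := by
          refine setLIntegral_mono' measurableSet_Ioc fun κ hκ => ?_
          set μ := 2 * κ - 1 / 2 with hμ
          have hμ0 : 0 < μ := by linarith [hκ.1]
          set w := μ ^ (1 / 2 : ℝ) with hw
          have hw0 : 0 < w := by positivity
          have hw1 : μ ^ (-(1 / 2) : ℝ) = w⁻¹ := Real.rpow_neg hμ0.le _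
          have hw2 : w * w = μ := by
            rw [hw, ← Real.rpow_add hμ0]; norm_num
          calc ∫⁻ τ in Icc T (3 * T), ‖twistZeta (2 * (κ + τ * Complex.I))‖ₑ
              ≤ ∫⁻ τ in Icc T (3 * T), (ENNReal.ofReal w *
                  ‖twistZeta (2 * (κ + τ * Complex.I))‖ₑ ^ 2 + ENNReal.ofReal w⁻¹) := by
                refine lintegral_mono fun τ => ?_
                set a := ‖twistZeta (2 * (κ + τ * Complex.I))‖ with ha
                have ha0 : 0 ≤ a := norm_nonneg _
                rw [← ofReal_norm, ← ha, ← ENNReal.ofReal_pow ha0,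
                  ← ENNReal.ofReal_mul hw0.le, ← ENNReal.ofReal_add (by positivity) (by positivity)]
                apply ENNReal.ofReal_le_ofReal
                have h1 : w * (w * a ^ 2 + w⁻¹ - a) = (w * a - 1 / 2) ^ 2 + 3 / 4 := by
                  field_simp
                  ring
                have h2 : 0 < w * (w * a ^ 2 + w⁻¹ - a) := by rw [h1]; positivity
                have := pos_of_mul_pos_right h2 hw0.le
                linarith
            _ = ENNReal.ofReal w * (∫⁻ τ in Icc T (3 * T),
                  ‖twistZeta (2 * (κ + τ * Complex.I))‖ₑ ^ 2) +
                ENNReal.ofReal w⁻¹ * ENNReal.ofReal (3 * T - T) := by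
                rw [lintegral_add_right _ measurable_const,
                  lintegral_const_mul' _ _ ENNReal.ofReal_ne_top, setLIntegral_const,
                  Real.volume_Icc]
            _ ≤ ENNReal.ofReal w * ENNReal.ofReal (C * T / μ) +
                ENNReal.ofReal w⁻¹ * ENNReal.ofReal (3 * T - T) := by
                gcongr
                exact hC T hT κ hκ.1 hκ.2
            _ = _ := by
                rw [hw1, ← ENNReal.ofReal_mul hw0.le, ← ENNReal.ofReal_mul (by positivity),
                  ← ENNReal.ofReal_mul (by positivity), ← ENNReal.ofReal_add (by positivity)]
                · congr 1
                  rw [← hw2]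
                  field_simp
                  ring
                · have : 0 ≤ 3 * T - T := by linarith
                  positivity
      _ = ENNReal.ofReal ((C + 2) * T) * ENNReal.ofReal I.toReal := by
          rw [lintegral_const_mul' _ _ ENNReal.ofReal_ne_top, ENNReal.ofReal_toReal hI]
      _ ≤ _ := by
          rw [← ENNReal.ofReal_mul (by positivity)]
          apply ENNReal.ofReal_le_ofReal
          have := ENNReal.toReal_nonneg (a := I)
          nlinarith
  · rw [Measure.prod_restrict]
    refine ContinuousOn.aemeasurable ?_ (measurableSet_Icc.prod measurableSet_Ioc)
    refine continuous_enorm.comp_continuousOn ?_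
    have h := continuousOn_twistZeta_two_mul.comp (f := Prod.swap) (s := Icc T (3 * T) ×ˢ Ioc (1 / 4 : ℝ) (3 / 2))
      continuous_swap.continuousOn fun x hx => ⟨mem_univ _, hT0.trans_le hx.1.1⟩
    exact h

/-- The Mellin transform of the rotated theta function on the line `re z = 1/4`, normalised to be
real. -/
noncomputable def twistLine (α τ : ℝ) : ℂ :=
  Complex.exp (α * Complex.I / 4) * mellin (twistRay α) ((1 / 4 : ℝ) + τ * Complex.I)

theorem twistLine_eq_fourier (α τ : ℝ) :
    twistLine α τ = FourierTransform.fourier (twistKernel α) (τ / (2 * Real.pi)) := by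
  rw [twistLine, mellin_twistRay]
  simp

theorem twistLine_eq_integral (α τ : ℝ) :
    twistLine α τ = ∫ u : ℝ, Complex.exp (-(τ * u * Complex.I)) * twistKernel α u := by
  rw [twistLine_eq_fourier, Real.fourier_real_eq_integral_exp_smul]
  refine MeasureTheory.integral_congr_ae (Filter.Eventually.of_forall fun u => ?_)
  have h : -2 * Real.pi * u * (τ / (2 * Real.pi)) = -(τ * u) := by
    field_simp
  simp only [h, smul_eq_mul]
  push_cast
  ring_nf

theorem integrable_twistKernel {α : ℝ} (h1 : -(Real.pi / 2) < α) (h2 : α < Real.pi / 2) :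
    MeasureTheory.Integrable (twistKernel α) := by
  simpa using integrable_exp_mul_twistKernel h1 h2 0

theorem conj_twistLine {α : ℝ} (h1 : -(Real.pi / 2) < α) (h2 : α < Real.pi / 2) (τ : ℝ) :
    starRingEnd ℂ (twistLine α τ) = twistLine α τ := by
  rw [twistLine_eq_integral, ← integral_conj, ← MeasureTheory.integral_neg_eq_self]
  refine MeasureTheory.integral_congr_ae (Filter.Eventually.of_forall fun u => ?_)
  simp only [map_mul, twistKernel_neg h1 h2, Complex.conj_conj, ← Complex.exp_conj]
  simp

theorem ofReal_re_twistLine {α : ℝ} (h1 : -(Real.pi / 2) < α) (h2 : α < Real.pi / 2) (τ : ℝ) :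
    ((twistLine α τ).re : ℂ) = twistLine α τ :=
  Complex.conj_eq_iff_re.mp (conj_twistLine h1 h2 τ)

theorem continuous_twistLine {α : ℝ} (h1 : -(Real.pi / 2) < α) (h2 : α < Real.pi / 2) :
    Continuous (twistLine α) := by
  refine continuous_const.mul (continuous_iff_continuousAt.mpr fun τ => ?_)
  exact ContinuousAt.comp (f := fun τ : ℝ => (((1 / 4 : ℝ) : ℂ) + τ * Complex.I))
    (differentiableAt_mellin_twistRay h1 h2 (by simp)).continuousAt (by fun_prop)

open MeasureTheory Set in
theorem integral_twistLine_eq_fourier {α : ℝ} (h1 : -(Real.pi / 2) < α) (h2 : α < Real.pi / 2)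
    (H τ : ℝ) : ∫ v in 0..H, twistLine α (τ + v) = FourierTransform.fourier
      (fun u : ℝ => (∫ v in 0..H, Complex.exp (-(v * u * Complex.I))) * twistKernel α u)
      (τ / (2 * Real.pi)) := by
  simp_rw [twistLine_eq_integral]
  rw [intervalIntegral_integral_swap, Real.fourier_real_eq_integral_exp_smul]
  · refine integral_congr_ae (Filter.Eventually.of_forall fun u => ?_)
    have h : -2 * Real.pi * u * (τ / (2 * Real.pi)) = -(τ * u) := by
      field_simp
    simp only [h, smul_eq_mul]
    rw [intervalIntegral.integral_mul_const, ← mul_assoc, ← intervalIntegral.integral_const_mul]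
    congr 2
    ext v
    rw [← Complex.exp_add]
    congr 1
    push_cast
    ring
  · have h3 : Integrable (fun z : ℝ × ℝ => (1 : ℂ) * twistKernel α z.2)
        ((volume.restrict (uIoc 0 H)).prod volume) :=
      Integrable.mul_prod (f := fun _ : ℝ => (1 : ℂ)) intervalIntegrable_const.def'
        (integrable_twistKernel h1 h2)
    simp only [one_mul] at h3
    refine h3.bdd_mul (c := 1) (f := fun z : ℝ × ℝ => Complex.exp (-(((τ + z.1 : ℝ) : ℂ) * z.2 * Complex.I)))
      (Continuous.aestronglyMeasurable (by fun_prop)) (Filter.Eventually.of_forall fun z => ?_)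
    rw [Complex.norm_exp]
    simp

theorem norm_integral_exp_sq_mul_le {H : ℝ} (hH : 0 ≤ H) (u : ℝ) :
    ‖∫ v in 0..H, Complex.exp (-(v * u * Complex.I))‖ ^ 2 * (1 + H ^ 2 * u ^ 2) ≤ 5 * H ^ 2 := by
  set k := ∫ v in 0..H, Complex.exp (-(v * u * Complex.I)) with hk
  have hn : ∀ v : ℝ, ‖Complex.exp (-(v * u * Complex.I))‖ = 1 := by
    intro v; rw [Complex.norm_exp]; simp
  have h1 : ‖k‖ ≤ H := by
    have := intervalIntegral.norm_integral_le_of_norm_le_const (a := 0) (b := H) (C := 1)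
      (f := fun v : ℝ => Complex.exp (-(v * u * Complex.I))) fun v _ => (hn v).le
    simpa [abs_of_nonneg hH] using this
  have h2 : ‖k‖ * |u| ≤ 2 := by
    by_cases hu : u = 0
    · simp [hu]
    have hc : -(u * Complex.I) ≠ 0 := by simp [hu]
    have h3 := integral_exp_mul_complex (a := 0) (b := H) hc
    have h4 : k = ∫ v in 0..H, Complex.exp (-(u * Complex.I) * (v : ℝ)) := by
      rw [hk]; congr 1; ext v; congr 1; ring
    rw [h4, h3, norm_div, norm_neg, norm_mul, Complex.norm_I, mul_one, Complex.norm_real,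
      Real.norm_eq_abs, div_mul_cancel₀ _ (abs_ne_zero.mpr hu)]
    refine (norm_sub_le _ _).trans ?_
    rw [Complex.norm_exp, Complex.norm_exp]
    simp
    norm_num
  have h3 : (‖k‖ * |u|) ^ 2 ≤ 2 ^ 2 := by gcongr
  have h4 : ‖k‖ ^ 2 ≤ H ^ 2 := by gcongr
  rw [mul_pow, sq_abs] at h3
  nlinarith [sq_nonneg H]

open MeasureTheory Set in
theorem lintegral_div_one_add_sq {H : ℝ} (hH : 0 < H) :
    ∫⁻ u : ℝ, ENNReal.ofReal (5 * H ^ 2 / (1 + H ^ 2 * u ^ 2)) =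
      ENNReal.ofReal (5 * Real.pi * H) := by
  have h1 := lintegral_comp_div_ofReal (a := 1 / H) (by positivity)
    fun x => ENNReal.ofReal (5 * H ^ 2 * (1 + x ^ 2)⁻¹)
  have h2 : ∀ u : ℝ, 5 * H ^ 2 / (1 + H ^ 2 * u ^ 2) = 5 * H ^ 2 * (1 + (u / (1 / H)) ^ 2)⁻¹ := by
    intro u
    rw [div_eq_mul_inv]
    congr 3
    field_simp
  simp_rw [h2]
  rw [h1, ← ofReal_integral_eq_lintegral_ofReal (integrable_inv_one_add_sq.const_mul _)
    (Filter.Eventually.of_forall fun x => by positivity), integral_const_mul,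
    integral_univ_inv_one_add_sq, ← ENNReal.ofReal_mul (by positivity)]
  congr 1
  field_simp

open MeasureTheory Set in
theorem exists_lintegral_integral_twistLine_sq_le : ∃ C : ℝ, 0 < C ∧ ∀ T : ℝ, 1 ≤ T →
    ∀ H : ℝ, 1 ≤ H →
    ∫⁻ τ : ℝ, ‖∫ v in 0..H, twistLine (Real.pi / 2 - 1 / T) (τ + v)‖ₑ ^ 2 ≤
      ENNReal.ofReal (C * (H * T ^ (1 / 2 : ℝ) + H ^ 2 * T ^ (3 / 8 : ℝ))) := by
  obtain ⟨C, hC0, hC⟩ := exists_lintegral_twistKernel_mul_le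
  refine ⟨2 * Real.pi * (30 * Real.pi * C * 4), by positivity, fun T hT H hH => ?_⟩
  have hT0 : 0 < T := by linarith
  have hH0 : 0 < H := by linarith
  have hδ1 : 1 / T ≤ 1 := (div_le_one hT0).mpr hT
  have hδ0 : 0 < 1 / T := by positivity
  have hp1 := one_div_two_mul_le_pi_div_four_mul_sin hT
  have hα1 : -(Real.pi / 2) < Real.pi / 2 - 1 / T := by linarith [Real.pi_gt_three]
  have hα2 : Real.pi / 2 - 1 / T < Real.pi / 2 := by linarith
  let k : ℝ → ENNReal := fun u => ENNReal.ofReal (5 * H ^ 2 / (1 + H ^ 2 * u ^ 2))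
  have hC' := hC (1 / T) hδ0 hδ1 (1 / H) (by positivity) ((div_le_one hH0).mpr hH) k
    (by fun_prop) (fun v _ => by simp [k]) 3 (by norm_num) (fun v v' hv' => by
      have e3 : (3 : ENNReal) = ENNReal.ofReal 3 := by simp
      simp only [k]
      rw [e3, ← ENNReal.ofReal_mul (by norm_num), ← mul_div_assoc]
      apply ENNReal.ofReal_le_ofReal
      rw [div_le_div_iff₀ (by positivity) (by positivity)]
      have h1 : 0 ≤ H * (v - v') := mul_nonneg hH0.le (by linarith [hv'.2])
      have h2 : H * (v - v') ≤ 1 := by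
        calc H * (v - v') ≤ H * (1 / H) := by gcongr; linarith [hv'.1]
          _ = 1 := by field_simp
      have h3 : 1 + H ^ 2 * v' ^ 2 ≤ 3 * (1 + H ^ 2 * v ^ 2) := by
        nlinarith [sq_nonneg (H * v + H * (v - v'))]
      nlinarith [mul_le_mul_of_nonneg_left h3 (by positivity : 0 ≤ 5 * H ^ 2)])
  set α := Real.pi / 2 - 1 / T
  set p := Real.pi / 4 * Real.sin (1 / T)
  have hp0 : 0 < p := lt_of_lt_of_le (by positivity) hp1
  have hk1 : ∫⁻ v, k v * ENNReal.ofReal (Real.exp (-(p * Real.exp v / 2))) ≤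
      ENNReal.ofReal (5 * Real.pi * H) := by
    rw [← lintegral_div_one_add_sq hH0]
    refine lintegral_mono fun v => mul_le_of_le_one_right' ?_
    rw [ENNReal.ofReal_le_one, Real.exp_le_one_iff]
    have := Real.exp_pos v
    have : 0 < p * Real.exp v / 2 := by positivity
    linarith
  let κ : ℝ → ℂ := fun u => ∫ v in 0..H, Complex.exp (-(v * u * Complex.I))
  have hκ : ∀ u, ‖κ u‖ₑ ^ 2 ≤ k u := by
    intro u
    rw [← ofReal_norm, ← ENNReal.ofReal_pow (norm_nonneg _)]
    apply ENNReal.ofReal_le_ofReal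
    rw [le_div_iff₀ (by positivity)]
    exact norm_integral_exp_sq_mul_le hH0.le u
  have hκc : Continuous κ := by
    apply intervalIntegral.continuous_parametric_intervalIntegral_of_continuous' (by fun_prop)
  have hint : Integrable fun u => κ u * twistKernel α u := by
    refine (integrable_twistKernel hα1 hα2).bdd_mul (c := H) hκc.aestronglyMeasurable
      (Filter.Eventually.of_forall fun u => ?_)
    have := intervalIntegral.norm_integral_le_of_norm_le_const (a := 0) (b := H) (C := 1)
      (f := fun v : ℝ => Complex.exp (-(v * u * Complex.I))) fun v _ => by
        rw [Complex.norm_exp]; simp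
    simpa [abs_of_pos hH0] using this
  have hpow : ∀ a : ℝ, 0 ≤ a → a ≤ 1 → p ^ (-a) ≤ 2 * T ^ a := by
    intro a ha0 ha1
    calc p ^ (-a) ≤ (1 / (2 * T)) ^ (-a) :=
          Real.rpow_le_rpow_of_nonpos (by positivity) hp1 (by linarith)
      _ = 2 ^ a * T ^ a := by
          rw [one_div, Real.inv_rpow (by positivity), Real.rpow_neg (by positivity),
            inv_inv, Real.mul_rpow (by norm_num) hT0.le]
      _ ≤ 2 ^ (1 : ℝ) * T ^ a := by
          gcongr
          norm_num
      _ = _ := by norm_num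
  simp_rw [integral_twistLine_eq_fourier hα1 hα2 H]
  refine (lintegral_enorm_fourier_div_sq_le hint).trans ?_
  rw [mul_assoc (2 * Real.pi), ENNReal.ofReal_mul (p := 2 * Real.pi) (by positivity)]
  refine mul_le_mul_right ?_ _
  have h5 : ENNReal.ofReal (1 / H) * ∫⁻ u, ‖κ u * twistKernel α u‖ₑ ^ 2 ≤
      ENNReal.ofReal (1 / H) * ENNReal.ofReal (30 * Real.pi * C * 4 *
        (H * T ^ (1 / 2 : ℝ) + H ^ 2 * T ^ (3 / 8 : ℝ))) := by
    calc _ ≤ ENNReal.ofReal (1 / H) * ∫⁻ u, ‖twistKernel α u‖ₑ ^ 2 * k u := by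
          gcongr with u
          rw [enorm_mul, mul_pow, mul_comm]
          gcongr
          exact hκ u
      _ ≤ _ := hC'
      _ ≤ _ := mul_le_mul_right hk1 _
      _ ≤ _ := by
          have e2 : (2 * 3 : ENNReal) = ENNReal.ofReal 6 := by norm_num
          rw [e2, ← ENNReal.ofReal_mul (by positivity), ← ENNReal.ofReal_mul (by positivity),
            ← ENNReal.ofReal_mul (by positivity)]
          apply ENNReal.ofReal_le_ofReal
          calc 6 * (C * (2 * (1 / H) * p ^ (-(1 / 2) : ℝ) + p ^ (-(3 / 8) : ℝ))) * (5 * Real.pi * H)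
              ≤ 6 * (C * (2 * (1 / H) * (2 * T ^ (1 / 2 : ℝ)) + 2 * T ^ (3 / 8 : ℝ))) *
                (5 * Real.pi * H) := by
                gcongr
                · exact hpow _ (by norm_num) (by norm_num)
                · exact hpow _ (by norm_num) (by norm_num)
            _ = 1 / H * (30 * Real.pi * C * 2 *
                  (2 * H * T ^ (1 / 2 : ℝ) + H ^ 2 * T ^ (3 / 8 : ℝ))) := by
                field_simp
                ring
            _ ≤ 1 / H * (30 * Real.pi * C * 2 *
                  (2 * H * T ^ (1 / 2 : ℝ) + 2 * (H ^ 2 * T ^ (3 / 8 : ℝ)))) := by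
                refine mul_le_mul_of_nonneg_left (mul_le_mul_of_nonneg_left ?_ (by positivity))
                  (by positivity)
                have : 0 ≤ H ^ 2 * T ^ (3 / 8 : ℝ) := by positivity
                linarith
            _ = _ := by ring
  exact (ENNReal.mul_le_mul_iff_right (by simpa using hH0) ENNReal.ofReal_ne_top).mp h5

theorem abs_integral_eq_of_ne_zero {f : ℝ → ℝ} {a b : ℝ} (hab : a ≤ b)
    (hf : ContinuousOn f (Set.Icc a b)) (h0 : ∀ x ∈ Set.Icc a b, f x ≠ 0) :
    |∫ x in a..b, f x| = ∫ x in a..b, |f x| := by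
  have hsign : (∀ x ∈ Set.Icc a b, 0 < f x) ∨ ∀ x ∈ Set.Icc a b, f x < 0 := by
    by_contra! h
    obtain ⟨⟨x, hx, hx'⟩, ⟨y, hy, hy'⟩⟩ := h
    obtain ⟨z, hz, hz'⟩ := isPreconnected_Icc.intermediate_value hx hy hf ⟨hx', hy'⟩
    exact h0 z hz hz'
  rcases hsign with h | h
  · rw [abs_of_nonneg (intervalIntegral.integral_nonneg hab fun x hx => (h x hx).le)]
    refine intervalIntegral.integral_congr fun x hx => ?_
    rw [Set.uIcc_of_le hab] at hx
    exact (abs_of_pos (h x hx)).symm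
  · have h1 : ∫ x in a..b, |f x| = ∫ x in a..b, -f x := by
      refine intervalIntegral.integral_congr fun x hx => ?_
      rw [Set.uIcc_of_le hab] at hx
      exact abs_of_neg (h x hx)
    rw [h1, intervalIntegral.integral_neg, abs_of_nonpos]
    rw [← neg_nonneg, ← intervalIntegral.integral_neg]
    exact intervalIntegral.integral_nonneg hab fun x hx => by linarith [h x hx]

theorem half_le_norm_integral_twistZeta_add {t H : ℝ} (ht : 0 < t) (hH : 0 < H) :
    H / 2 ≤ ‖∫ u in t..t + H, twistZeta (2 * ((1 / 4 : ℝ) + u * Complex.I))‖ +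
      (‖∫ κ in (1 / 4 : ℝ)..(3 / 2), twistZeta (2 * (κ + t * Complex.I))‖ +
        ‖∫ κ in (1 / 4 : ℝ)..(3 / 2), twistZeta (2 * (κ + (t + H : ℝ) * Complex.I))‖) := by
  have h := Complex.integral_boundary_rect_eq_zero_of_differentiableOn
    (fun z => twistZeta (2 * z)) ⟨1 / 4, t⟩ ⟨3 / 2, t + H⟩ (by
      intro z hz
      have hz : z.im ∈ Set.uIcc t (t + H) := hz.2
      rw [Set.uIcc_of_le (by linarith)] at hz
      refine DifferentiableAt.differentiableWithinAt ?_
      refine DifferentiableAt.comp z (differentiableAt_twistZeta fun h => ?_) (by fun_prop)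
      have := congrArg Complex.im h
      simp at this
      linarith [hz.1])
  simp only [smul_eq_mul] at h
  set A := ∫ κ in (1 / 4 : ℝ)..(3 / 2), twistZeta (2 * (κ + t * Complex.I))
  set B := ∫ κ in (1 / 4 : ℝ)..(3 / 2), twistZeta (2 * (κ + (t + H : ℝ) * Complex.I))
  set L := ∫ u in t..t + H, twistZeta (2 * ((1 / 4 : ℝ) + u * Complex.I))
  set R := ∫ u in t..t + H, twistZeta (2 * ((3 / 2 : ℝ) + u * Complex.I)) with hR
  have hR1 : H / 2 ≤ R.re := by
    have hpt : ∀ u : ℝ, twistZeta (2 * ((3 / 2 : ℝ) + u * Complex.I)) =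
        twistZeta (3 + (2 * u : ℝ) * Complex.I) := by
      intro u; congr 1; push_cast; ring
    have hcont : ContinuousOn (fun u : ℝ => twistZeta (3 + (2 * u : ℝ) * Complex.I))
        (Set.uIcc t (t + H)) := by
      intro u hu
      refine ContinuousAt.continuousWithinAt ?_
      refine ContinuousAt.comp (f := fun u : ℝ => (3 + (2 * u : ℝ) * Complex.I : ℂ))
        (differentiableAt_twistZeta fun h => ?_).continuousAt (by fun_prop)
      have := congrArg Complex.re h
      norm_num at this
    have hint := hcont.intervalIntegrable (μ := MeasureTheory.volume)
    have h1 : R.re = ∫ u in t..t + H, (twistZeta (3 + (2 * u : ℝ) * Complex.I)).re := by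
      rw [hR]
      simp_rw [hpt]
      exact (Complex.reCLM.intervalIntegral_comp_comm hint).symm
    have h2 : ∫ u in t..t + H, (1 / 2 : ℝ) = H / 2 := by
      rw [intervalIntegral.integral_const, smul_eq_mul]; ring
    rw [h1, ← h2]
    refine intervalIntegral.integral_mono_on (by linarith) (by simp) ?_ fun u _ => re_twistZeta_ge
    exact (Complex.continuous_re.comp_continuousOn hcont).intervalIntegrable
  have h2 : Complex.I * R = Complex.I * L + (B - A) := by
    linear_combination h
  calc H / 2 ≤ ‖R‖ := hR1.trans (Complex.re_le_norm R)
    _ = ‖Complex.I * R‖ := by simp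
    _ ≤ ‖Complex.I * L‖ + ‖B - A‖ := by rw [h2]; exact norm_add_le _ _
    _ ≤ ‖L‖ + (‖B‖ + ‖A‖) := by
        gcongr
        · simp
        · exact norm_sub_le _ _
    _ = _ := by ring

theorem exists_le_norm_integral_twistLine : ∃ c : ℝ, 0 < c ∧ ∀ T : ℝ, 1 ≤ T → ∀ H : ℝ, 0 < H →
    H ≤ T → ∀ t ∈ Set.Icc T (2 * T),
    (∀ u ∈ Set.Icc t (t + H), riemannZeta (1 / 2 + (2 * u : ℝ) * Complex.I) ≠ 0) →
    ‖∫ u in t..t + H, twistZeta (2 * ((1 / 4 : ℝ) + u * Complex.I))‖ ≤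
      c * T ^ (1 / 4 : ℝ) * ‖∫ v in 0..H, twistLine (Real.pi / 2 - 1 / T) (t + v)‖ := by
  obtain ⟨c, hc0, hc⟩ := exists_norm_mellin_twistRay_ge
  refine ⟨c⁻¹, by positivity, fun T hT H hH0 hHT t ht hz => ?_⟩
  have hT0 : 0 < T := by linarith
  have ht0 : 0 < t := hT0.trans_le ht.1
  have hδ1 : 1 / T ≤ 1 := (div_le_one hT0).mpr hT
  have hδ0 : 0 < 1 / T := by positivity
  have hα1 : -(Real.pi / 2) < Real.pi / 2 - 1 / T := by linarith [Real.pi_gt_three]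
  have hα2 : Real.pi / 2 - 1 / T < Real.pi / 2 := by linarith
  set α := Real.pi / 2 - 1 / T
  have hF := continuous_twistLine hα1 hα2
  have hle : ∀ u ∈ Set.Icc t (t + H), ‖twistZeta (2 * ((1 / 4 : ℝ) + u * Complex.I))‖ ≤
      c⁻¹ * T ^ (1 / 4 : ℝ) * ‖twistLine α u‖ := by
    intro u hu
    have h1 := hc T hT (1 / 4) (by norm_num) u ⟨ht.1.trans hu.1, by linarith [hu.2, ht.2]⟩
    have h2 : ‖twistLine α u‖ = ‖mellin (twistRay α) ((1 / 4 : ℝ) + u * Complex.I)‖ := by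
      rw [twistLine, norm_mul, Complex.norm_exp]
      simp
    rw [h2]
    calc _ = c⁻¹ * T ^ (1 / 4 : ℝ) * (c * T ^ (1 / 4 - 1 / 2 : ℝ) *
            ‖twistZeta (2 * ((1 / 4 : ℝ) + u * Complex.I))‖) := by
          have : T ^ (1 / 4 : ℝ) * T ^ (1 / 4 - 1 / 2 : ℝ) = 1 := by
            rw [← Real.rpow_add hT0]; norm_num
          calc _ = (c⁻¹ * c) * (T ^ (1 / 4 : ℝ) * T ^ (1 / 4 - 1 / 2 : ℝ)) *
                ‖twistZeta (2 * ((1 / 4 : ℝ) + u * Complex.I))‖ := by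
                rw [this, inv_mul_cancel₀ hc0.ne', one_mul, one_mul]
            _ = _ := by ring
      _ ≤ _ := by gcongr
  have hne : ∀ u ∈ Set.Icc t (t + H), (twistLine α u).re ≠ 0 := by
    intro u hu h0
    have h1 : twistLine α u = 0 := by
      rw [← ofReal_re_twistLine hα1 hα2, h0, Complex.ofReal_zero]
    have h2 := hle u hu
    rw [h1, norm_zero, mul_zero, norm_le_zero_iff] at h2
    have h3 : (2 * ((1 / 4 : ℝ) + u * Complex.I) : ℂ) = 1 / 2 + (2 * u : ℝ) * Complex.I := by
      push_cast; ring
    rw [h3] at h2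
    exact twistZeta_ne_zero (hz u hu) h2
  have hD : ‖∫ v in 0..H, twistLine α (t + v)‖ = ∫ u in t..t + H, ‖twistLine α u‖ := by
    rw [intervalIntegral.integral_comp_add_left (fun u => twistLine α u), add_zero]
    have h1 : ∀ u, ‖twistLine α u‖ = |(twistLine α u).re| := by
      intro u
      conv_lhs => rw [← ofReal_re_twistLine hα1 hα2, Complex.norm_real, Real.norm_eq_abs]
    have h2 : ∫ u in t..t + H, twistLine α u =
        ((∫ u in t..t + H, (twistLine α u).re : ℝ) : ℂ) := by
      rw [← intervalIntegral.integral_ofReal]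
      exact intervalIntegral.integral_congr fun u _ => (ofReal_re_twistLine hα1 hα2 u).symm
    simp_rw [h1]
    rw [h2, Complex.norm_real, Real.norm_eq_abs]
    exact abs_integral_eq_of_ne_zero (by linarith)
      (Complex.continuous_re.comp hF).continuousOn hne
  rw [hD, ← intervalIntegral.integral_const_mul]
  refine intervalIntegral.norm_integral_le_of_norm_le (by linarith) ?_ ?_
  · exact Filter.Eventually.of_forall fun u hu => hle u ⟨hu.1.le, hu.2⟩
  · exact (by fun_prop : Continuous fun u => c⁻¹ * T ^ (1 / 4 : ℝ) * ‖twistLine α u‖).intervalIntegrable _ _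

theorem measurable_twistZeta : Measurable twistZeta :=
  measurable_of_continuousOn_compl_singleton 1 fun _ hs =>
    (differentiableAt_twistZeta hs).continuousAt.continuousWithinAt

open MeasureTheory Set in
theorem ofReal_norm_integral_twistZeta_le (t : ℝ) :
    ENNReal.ofReal ‖∫ κ in (1 / 4 : ℝ)..(3 / 2), twistZeta (2 * (κ + t * Complex.I))‖ ≤
      ∫⁻ κ in Ioc (1 / 4 : ℝ) (3 / 2), ‖twistZeta (2 * (κ + t * Complex.I))‖ₑ := by
  rw [intervalIntegral.integral_of_le (by norm_num), ofReal_norm]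
  exact enorm_integral_le_lintegral_enorm _

open MeasureTheory Set in
/-- Under summability of the reciprocals of the ordinates, few of them meet a given window. -/
theorem exists_forall_volume_window_le
    (h : Summable (fun γ : {t : ℝ // t ≠ 0 ∧ riemannZeta (1 / 2 + t * Complex.I) = 0} =>
      1 / |γ.val|)) {H : ℝ} (hH : 0 < H) :
    ∃ T₀ : ℝ, ∀ T : ℝ, T₀ ≤ T → H ≤ T →
      volume {t ∈ Icc T (2 * T) | ∃ u ∈ Icc t (t + H),
        riemannZeta (1 / 2 + (2 * u : ℝ) * Complex.I) = 0} ≤ ENNReal.ofReal (T / 4) := by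
  set f : {t : ℝ // t ≠ 0 ∧ riemannZeta (1 / 2 + t * Complex.I) = 0} → ℝ := fun γ => 1 / |γ.val|
  have hf0 : ∀ γ, 0 ≤ f γ := fun γ => by positivity
  have hcount : Countable {t : ℝ // t ≠ 0 ∧ riemannZeta (1 / 2 + t * Complex.I) = 0} := by
    have h1 := h.countable_support
    have h2 : Function.support f = univ := by
      ext γ
      simp [f, γ.2.1]
    rw [h2] at h1
    exact countable_univ_iff.mp h1
  obtain ⟨s, hs⟩ := ((tendsto_order.mp (tendsto_tsum_compl_atTop_zero f)).2 (1 / (24 * H))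
    (by positivity)).exists
  obtain ⟨M, hM⟩ := (s.image fun γ => |γ.val|).bddAbove
  refine ⟨max M 1, fun T hT hHT => ?_⟩
  have hT1 : 1 ≤ T := (le_max_right _ _).trans hT
  have hTM : M ≤ T := (le_max_left _ _).trans hT
  have hsub : {t ∈ Icc T (2 * T) | ∃ u ∈ Icc t (t + H),
      riemannZeta (1 / 2 + (2 * u : ℝ) * Complex.I) = 0} ⊆
      ⋃ γ : {γ // γ ∉ s}, {x | γ.1.1 ≤ 6 * T ∧ 0 < γ.1.1 ∧
        x ∈ Icc (γ.1.1 / 2 - H) (γ.1.1 / 2)} := by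
    rintro t ⟨ht, u, hu, hz⟩
    have hu0 : T ≤ u := ht.1.trans hu.1
    refine mem_iUnion.mpr ⟨⟨⟨2 * u, by linarith, hz⟩, fun hmem => ?_⟩, ?_⟩
    · have := hM (Finset.mem_coe.mpr (Finset.mem_image_of_mem _ hmem))
      simp only at this
      rw [abs_of_pos (by linarith)] at this
      linarith
    · refine ⟨?_, ?_, ?_, ?_⟩ <;> simp only <;> linarith [hu.1, hu.2, ht.2]
  have hvol : ∀ γ : {γ // γ ∉ s}, volume {x | γ.1.1 ≤ 6 * T ∧ 0 < γ.1.1 ∧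
      x ∈ Icc (γ.1.1 / 2 - H) (γ.1.1 / 2)} ≤ ENNReal.ofReal (6 * T * H * f γ.1) := by
    intro γ
    by_cases hγ : γ.1.1 ≤ 6 * T ∧ 0 < γ.1.1
    · calc _ ≤ volume (Icc (γ.1.1 / 2 - H) (γ.1.1 / 2)) := measure_mono fun x hx => hx.2.2
        _ = ENNReal.ofReal H := by rw [Real.volume_Icc]; congr 1; ring
        _ ≤ _ := by
          apply ENNReal.ofReal_le_ofReal
          have h1 : 1 ≤ 6 * T * f γ.1 := by
            simp only [f]
            rw [abs_of_pos hγ.2, mul_one_div, one_le_div hγ.2]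
            exact hγ.1
          nlinarith
    · have : {x | γ.1.1 ≤ 6 * T ∧ 0 < γ.1.1 ∧ x ∈ Icc (γ.1.1 / 2 - H) (γ.1.1 / 2)} = ∅ := by
        ext x
        simp only [Set.mem_ofPred_eq, mem_empty_iff_false, iff_false]
        tauto
      rw [this, measure_empty]
      exact zero_le
  calc _ ≤ _ := measure_mono hsub
    _ ≤ ∑' γ : {γ // γ ∉ s}, ENNReal.ofReal (6 * T * H * f γ.1) :=
        (measure_iUnion_le _).trans (ENNReal.tsum_le_tsum hvol)
    _ = ENNReal.ofReal (∑' γ : {γ // γ ∉ s}, 6 * T * H * f γ.1) :=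
        (ENNReal.ofReal_tsum_of_nonneg (fun γ => mul_nonneg (by positivity) (hf0 _))
          ((h.subtype _).mul_left _)).symm
    _ ≤ _ := by
        apply ENNReal.ofReal_le_ofReal
        rw [tsum_mul_left]
        calc _ ≤ 6 * T * H * (1 / (24 * H)) := by gcongr
          _ = T / 4 := by field_simp; norm_num

open MeasureTheory Set in
/-- If few windows of length `H` contain a critical zero, then `H` is bounded. -/
theorem exists_forall_window_length_le : ∃ C : ℝ, 0 < C ∧ ∀ T : ℝ, 1 ≤ T → ∀ H : ℝ, 1 ≤ H →
    H ≤ T → volume {t ∈ Icc T (2 * T) | ∃ u ∈ Icc t (t + H),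
      riemannZeta (1 / 2 + (2 * u : ℝ) * Complex.I) = 0} ≤ ENNReal.ofReal (T / 4) →
    H / 4 * T ≤ C * (T + H * T ^ (7 / 8 : ℝ)) := by
  obtain ⟨C₁, hC₁0, hC₁⟩ := exists_lintegral_lintegral_twistZeta_le
  obtain ⟨C₂, hC₂0, hC₂⟩ := exists_lintegral_integral_twistLine_sq_le
  obtain ⟨c, hc0, hc⟩ := exists_le_norm_integral_twistLine
  refine ⟨2 * C₁ + 8 * c ^ 2 * C₂, by positivity, fun T hT H hH hHT hbad => ?_⟩
  have hT0 : 0 < T := by linarith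
  have hH0 : 0 < H := by linarith
  have hδ1 : 1 / T ≤ 1 := (div_le_one hT0).mpr hT
  have hδ0 : 0 < 1 / T := by positivity
  have hα1 : -(Real.pi / 2) < Real.pi / 2 - 1 / T := by linarith [Real.pi_gt_three]
  have hα2 : Real.pi / 2 - 1 / T < Real.pi / 2 := by linarith
  set bad := {t ∈ Icc T (2 * T) | ∃ u ∈ Icc t (t + H),
      riemannZeta (1 / 2 + (2 * u : ℝ) * Complex.I) = 0} with hbad_def
  let S := Icc T (2 * T) \ toMeasurable volume bad
  have hS : MeasurableSet S := measurableSet_Icc.diff (measurableSet_toMeasurable _ _)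
  have hSsub : S ⊆ Icc T (2 * T) := sdiff_subset
  have hSvol : ENNReal.ofReal (3 * T / 4) ≤ volume S := by
    calc ENNReal.ofReal (3 * T / 4) = volume (Icc T (2 * T)) - ENNReal.ofReal (T / 4) := by
          rw [Real.volume_Icc, ← ENNReal.ofReal_sub _ (by positivity)]
          congr 1
          ring
      _ ≤ volume (Icc T (2 * T)) - volume (toMeasurable volume bad) := by
          rw [measure_toMeasurable]
          exact tsub_le_tsub_left hbad _
      _ ≤ _ := le_measure_sdiff
  let G : ℝ → ENNReal := fun t => ∫⁻ κ in Ioc (1 / 4 : ℝ) (3 / 2),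
    ‖twistZeta (2 * (κ + t * Complex.I))‖ₑ
  have hG : Measurable G := by
    refine Measurable.lintegral_prod_right' (f := fun x : ℝ × ℝ =>
      ‖twistZeta (2 * (x.2 + x.1 * Complex.I))‖ₑ) ?_
    exact (measurable_twistZeta.comp (by fun_prop)).enorm
  let D : ℝ → ℂ := fun t => ∫ v in 0..H, twistLine (Real.pi / 2 - 1 / T) (t + v)
  have hD : Continuous D := by
    have := continuous_twistLine hα1 hα2
    exact intervalIntegral.continuous_parametric_intervalIntegral_of_continuous' (by fun_prop) _ _
  set K := 8 / H * (c * T ^ (1 / 4 : ℝ)) ^ 2 with hK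
  have hK0 : 0 ≤ K := by positivity
  have hpt : ∀ t ∈ S, ENNReal.ofReal (3 * H / 8) ≤
      G t + G (t + H) + ENNReal.ofReal K * ‖D t‖ₑ ^ 2 := by
    intro t ht
    have ht1 : t ∈ Icc T (2 * T) := hSsub ht
    have hz : ∀ u ∈ Icc t (t + H), riemannZeta (1 / 2 + (2 * u : ℝ) * Complex.I) ≠ 0 :=
      fun u hu h0 => ht.2 (subset_toMeasurable _ _ ⟨ht1, u, hu, h0⟩)
    have h1 := half_le_norm_integral_twistZeta_add (hT0.trans_le ht1.1) hH0
    have h2 := hc T hT H hH0 hHT t ht1 hz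
    set A := ‖∫ κ in (1 / 4 : ℝ)..(3 / 2), twistZeta (2 * (κ + t * Complex.I))‖ with hA
    set B := ‖∫ κ in (1 / 4 : ℝ)..(3 / 2), twistZeta (2 * (κ + (t + H : ℝ) * Complex.I))‖ with hB
    have h3 : c * T ^ (1 / 4 : ℝ) * ‖D t‖ ≤ H / 8 + K * ‖D t‖ ^ 2 := by
      set x := c * T ^ (1 / 4 : ℝ) * ‖D t‖ with hx
      have : K * ‖D t‖ ^ 2 = 8 / H * x ^ 2 := by rw [hK, hx]; ring
      rw [this]
      have h4 : H / 8 * (H / 8 + 8 / H * x ^ 2 - x) = (x - H / 16) ^ 2 + 3 * H ^ 2 / 256 := by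
        field_simp
        ring
      have h5 : 0 < H / 8 * (H / 8 + 8 / H * x ^ 2 - x) := by rw [h4]; positivity
      have := pos_of_mul_pos_right h5 (by positivity)
      linarith
    have h4 : 3 * H / 8 ≤ A + B + K * ‖D t‖ ^ 2 := by
      have h2' := h2.trans h3
      linarith
    calc _ ≤ ENNReal.ofReal (A + B + K * ‖D t‖ ^ 2) := ENNReal.ofReal_le_ofReal h4
      _ = ENNReal.ofReal A + ENNReal.ofReal B + ENNReal.ofReal K * ‖D t‖ₑ ^ 2 := by
          rw [ENNReal.ofReal_add (by positivity) (by positivity),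
            ENNReal.ofReal_add (norm_nonneg _) (norm_nonneg _), ENNReal.ofReal_mul hK0,
            ENNReal.ofReal_pow (norm_nonneg _), ofReal_norm (D t)]
      _ ≤ _ := by
          gcongr
          · exact ofReal_norm_integral_twistZeta_le t
          · exact ofReal_norm_integral_twistZeta_le (t + H)
  have hG1 : ∫⁻ t in S, G t ≤ ENNReal.ofReal (C₁ * T) := by
    refine (lintegral_mono_set fun t ht => ?_).trans (hC₁ T hT)
    exact ⟨(hSsub ht).1, by linarith [(hSsub ht).2]⟩
  have hG2 : ∫⁻ t in S, G (t + H) ≤ ENNReal.ofReal (C₁ * T) := by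
    refine le_trans ?_ (hC₁ T hT)
    rw [← lintegral_indicator hS, ← lintegral_indicator measurableSet_Icc,
      ← lintegral_add_right_eq_self ((Icc T (3 * T)).indicator fun τ =>
        ∫⁻ κ in Ioc (1 / 4 : ℝ) (3 / 2), ‖twistZeta (2 * (κ + τ * Complex.I))‖ₑ) H]
    refine lintegral_mono fun t => ?_
    by_cases ht : t ∈ S
    · have : t + H ∈ Icc T (3 * T) := ⟨by linarith [(hSsub ht).1], by linarith [(hSsub ht).2]⟩
      rw [indicator_of_mem ht, indicator_of_mem this]
    · rw [indicator_of_notMem ht]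
      exact zero_le
  have hmain : ENNReal.ofReal (3 * H / 8 * (3 * T / 4)) ≤ ENNReal.ofReal (C₁ * T + C₁ * T +
      K * (C₂ * (H * T ^ (1 / 2 : ℝ) + H ^ 2 * T ^ (3 / 8 : ℝ)))) := by
    calc _ = ENNReal.ofReal (3 * H / 8) * ENNReal.ofReal (3 * T / 4) :=
          ENNReal.ofReal_mul (by positivity)
      _ ≤ ENNReal.ofReal (3 * H / 8) * volume S := by gcongr
      _ = ∫⁻ t in S, ENNReal.ofReal (3 * H / 8) := by rw [setLIntegral_const]
      _ ≤ ∫⁻ t in S, (G t + G (t + H) + ENNReal.ofReal K * ‖D t‖ₑ ^ 2) :=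
          setLIntegral_mono' hS hpt
      _ = (∫⁻ t in S, G t) + (∫⁻ t in S, G (t + H)) +
            ENNReal.ofReal K * ∫⁻ t in S, ‖D t‖ₑ ^ 2 := by
          rw [lintegral_add_right _ (by fun_prop), lintegral_add_left hG,
            lintegral_const_mul' _ _ ENNReal.ofReal_ne_top]
      _ ≤ ENNReal.ofReal (C₁ * T) + ENNReal.ofReal (C₁ * T) + ENNReal.ofReal K *
            ENNReal.ofReal (C₂ * (H * T ^ (1 / 2 : ℝ) + H ^ 2 * T ^ (3 / 8 : ℝ))) := by
          gcongr
          exact (setLIntegral_le_lintegral _ _).trans (hC₂ T hT H hH)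
      _ = _ := by
          rw [← ENNReal.ofReal_mul hK0, ← ENNReal.ofReal_add (by positivity) (by positivity),
            ← ENNReal.ofReal_add (by positivity) (by positivity)]
  rw [ENNReal.ofReal_le_ofReal_iff (by positivity)] at hmain
  have hK1 : K * (C₂ * (H * T ^ (1 / 2 : ℝ) + H ^ 2 * T ^ (3 / 8 : ℝ))) =
      8 * c ^ 2 * C₂ * (T + H * T ^ (7 / 8 : ℝ)) := by
    have e1 : (T ^ (1 / 4 : ℝ)) ^ 2 = T ^ (1 / 2 : ℝ) := by
      rw [← Real.rpow_natCast, ← Real.rpow_mul hT0.le]; norm_num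
    have e2 : T ^ (1 / 2 : ℝ) * T ^ (1 / 2 : ℝ) = T := by
      rw [← Real.rpow_add hT0]; norm_num
    have e3 : T ^ (1 / 2 : ℝ) * T ^ (3 / 8 : ℝ) = T ^ (7 / 8 : ℝ) := by
      rw [← Real.rpow_add hT0]; norm_num
    calc _ = 8 * c ^ 2 * C₂ * (T ^ (1 / 2 : ℝ) * T ^ (1 / 2 : ℝ) +
          H * (T ^ (1 / 2 : ℝ) * T ^ (3 / 8 : ℝ))) := by
          rw [hK, mul_pow, e1]
          field_simp
      _ = _ := by rw [e2, e3]
  rw [hK1] at hmain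
  have h1 : 0 ≤ C₁ * (H * T ^ (7 / 8 : ℝ)) := by positivity
  have h2 : 0 < H * T := by positivity
  nlinarith

/-- The sum of `1/|γ|` over the real `γ ≠ 0` with `ζ(1/2 + iγ) = 0`
diverges: the function `γ ↦ 1/|γ|` on the set of ordinates of critical-line zeros of
the Riemann zeta function is not summable. -/
theorem not_summable_inv_abs_zeta_zero_ordinates :
    ¬ Summable (fun γ : {t : ℝ // t ≠ 0 ∧ riemannZeta (1 / 2 + t * Complex.I) = 0} =>
      1 / |γ.val|) := by
  intro h
  obtain ⟨C, hC0, hC⟩ := exists_forall_window_length_le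
  set H := 8 * C + 1 with hH
  have hH1 : 1 ≤ H := by linarith
  obtain ⟨T₀, hT₀⟩ := exists_forall_volume_window_le h (by linarith : 0 < H)
  set T := max T₀ (H ^ 8) with hT
  have hHT : H ≤ T := (le_self_pow₀ hH1 (by norm_num)).trans (le_max_right _ _)
  have hT1 : 1 ≤ T := hH1.trans hHT
  have h1 := hC T hT1 H hH1 hHT (hT₀ T (le_max_left _ _) hHT)
  have h2 : H * T ^ (7 / 8 : ℝ) ≤ T := by
    calc H * T ^ (7 / 8 : ℝ) = (H ^ 8) ^ (1 / 8 : ℝ) * T ^ (7 / 8 : ℝ) := by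
          rw [← Real.rpow_natCast, ← Real.rpow_mul (by linarith)]
          norm_num
      _ ≤ T ^ (1 / 8 : ℝ) * T ^ (7 / 8 : ℝ) := by
          gcongr
          exact le_max_right _ _
      _ = T := by
          rw [← Real.rpow_add (by linarith)]
          norm_num
  nlinarith
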